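/- arXiv:2507.01144 — 2 statements merged into one kernel-verified Lean document; each statement's English description precedes it below -/
import Mathlib

section
/- Assume conditions (A1)–(A4). Then lim_{n→∞} E_μ[M_n(g)²]/n = σ_g², where σ_g² := 2∫_X g χ_g dμ_* (which coincides with E_{μ_*}[M_1(g)²] for the stationary process). -/
open MeasureTheory Filter Set
open scoped ENNReal Topology NNReal

noncomputable section

variable {X : Type*} [MetricSpace X] [CompleteSpace X] [SecondCountableTopology X]
  [MeasurableSpace X] [BorelSpace X]

/-- Action of a transition kernel family on measures: `ν ↦ ν P_t`. -/
def measAct (P : ℝ → X → Measure X) (t : ℝ) (ν : Measure X) : Measure X :=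
  ν.bind (P t)

/-- Dual action of the semigroup on functions: `f ↦ P_t f`. -/
def funAct (P : ℝ → X → Measure X) (t : ℝ) (f : X → ℝ) (x : X) : ℝ :=
  ∫ y, f y ∂(P t x)

/-- A Borel (probability) measure has a finite first moment. -/
def FiniteFirstMoment (ν : Measure X) : Prop :=
  ∀ x₀ : X, Integrable (fun x => dist x₀ x) ν

/-- The Wasserstein (Kantorovich–Rubinstein) distance `d_W`. -/
def wassDist (μ ν : Measure X) : ℝ :=
  sSup {r | ∃ f : X → ℝ, LipschitzWith 1 f ∧ r = |(∫ x, f x ∂μ) - ∫ x, f x ∂ν|}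

/-- A Markov semigroup `{P_t}_{t ≥ 0}` of probability kernels on `X`. -/
structure IsMarkovSemigroup (P : ℝ → X → Measure X) : Prop where
  prob : ∀ t, 0 ≤ t → ∀ x, IsProbabilityMeasure (P t x)
  jointMeas : ∀ A : Set X, MeasurableSet A → Measurable fun p : ℝ × X => P p.1 p.2 A
  init : ∀ x, P 0 x = Measure.dirac x
  chapman : ∀ s t, 0 ≤ s → 0 ≤ t → ∀ x, P (s + t) x = (P s x).bind (P t)

/-- Condition (A1): stochastic continuity of the semigroup. -/
def CondA1 (P : ℝ → X → Measure X) : Prop :=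
  ∀ f : X → ℝ, Continuous f → (∃ C, ∀ x, |f x| ≤ C) →
    ∀ x : X, Tendsto (fun t => funAct P t f x) (𝓝[>] (0 : ℝ)) (𝓝 (f x))

/-- Condition (A2): the Feller property. -/
def CondA2 (P : ℝ → X → Measure X) : Prop :=
  ∀ f : X → ℝ, Continuous f → (∃ C, ∀ x, |f x| ≤ C) → ∀ t, 0 ≤ t →
    Continuous (funAct P t f) ∧ ∃ C, ∀ x, |funAct P t f x| ≤ C

/-- Condition (A3): preservation of finite first moments and exponential
contractivity in the Wasserstein distance, with rate `γ`. -/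
def CondA3 (P : ℝ → X → Measure X) (γ : ℝ) : Prop :=
  (∀ ν : Measure X, IsProbabilityMeasure ν → FiniteFirstMoment ν →
    ∀ t, 0 < t → FiniteFirstMoment (measAct P t ν)) ∧
  0 < γ ∧
  ∀ t, 0 ≤ t → ∀ x y : X,
    wassDist (P t x) (P t y) ≤ Real.exp (-γ * t) * dist x y

/-- Condition (A4): a uniform-in-time moment bound of order `ζ > 2` for the initial
distribution `μ`, along the semigroup. -/
def CondA4 (P : ℝ → X → Measure X) (μ : Measure X) (x₀ : X) (ζ : ℝ) : Prop :=
  2 < ζ ∧ ∃ M : ℝ, ∀ t, 0 ≤ t →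
    (∫⁻ x, ENNReal.ofReal (dist x₀ x ^ ζ) ∂(measAct P t μ)) ≤ ENNReal.ofReal M

variable {Ω : Type*} [MeasurableSpace Ω]

/-- The natural filtration of the process `Φ`. -/
def natFiltration (Φ : ℝ → Ω → X) (s : ℝ) : MeasurableSpace Ω :=
  ⨆ u ∈ Set.Icc (0 : ℝ) s, MeasurableSpace.comap (Φ u) inferInstance

/-- A (progressively measurable) time-homogeneous Markov process with state space `X`,
transition semigroup `P` and initial distribution `μ`, realized on `(Ω, ℙ)`. -/
structure IsMarkovProcess (P : ℝ → X → Measure X) (Φ : ℝ → Ω → X)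
    (ℙ : Measure Ω) (μ : Measure X) : Prop where
  jointMeas : Measurable fun p : ℝ × Ω => Φ p.1 p.2
  init : ℙ.map (Φ 0) = μ
  law : ∀ t, 0 ≤ t → ℙ.map (Φ t) = measAct P t μ
  markov : ∀ f : X → ℝ, Measurable f → (∃ C, ∀ x, |f x| ≤ C) →
    ∀ s t : ℝ, 0 ≤ s → 0 ≤ t →
      (fun ω => funAct P t f (Φ s ω)) =ᵐ[ℙ]
        ℙ[(fun ω => f (Φ (s + t) ω)) | natFiltration Φ s]

/-- A Markov process together with a measurable family of laws `{ℙ_x}_{x ∈ X}`,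
with `ℙ_x(Φ_0 = x) = 1`. -/
structure IsMarkovFamily (P : ℝ → X → Measure X) (Φ : ℝ → Ω → X)
    (ℙ : X → Measure Ω) : Prop where
  prob : ∀ x, IsProbabilityMeasure (ℙ x)
  jointMeas : Measurable fun p : ℝ × Ω => Φ p.1 p.2
  measFam : ∀ s : Set Ω, MeasurableSet s → Measurable fun x => ℙ x s
  start : ∀ x, (ℙ x) {ω | Φ 0 ω = x} = 1
  law : ∀ x, ∀ t, 0 ≤ t → (ℙ x).map (Φ t) = P t x
  markov : ∀ x : X, ∀ f : X → ℝ, Measurable f → (∃ C, ∀ z, |f z| ≤ C) →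
    ∀ s t : ℝ, 0 ≤ s → 0 ≤ t →
      (fun ω => funAct P t f (Φ s ω)) =ᵐ[ℙ x]
        (ℙ x)[(fun ω => f (Φ (s + t) ω)) | natFiltration Φ s]

/-- The corrector function `χ_g(x) = ∫_0^∞ (P_t g)(x) dt`. -/
def corrector (P : ℝ → X → Measure X) (g : X → ℝ) (x : X) : ℝ :=
  ∫ t in Set.Ioi (0 : ℝ), funAct P t g x

/-- The additive functional `I_t(g) = ∫_0^t g(Φ_s) ds`. -/
def addFun (g : X → ℝ) (Φ : ℝ → Ω → X) (t : ℝ) (ω : Ω) : ℝ :=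
  ∫ s in (0 : ℝ)..t, g (Φ s ω)

/-- The martingale part `M_t(g) = χ_g(Φ_t) - χ_g(Φ_0) + I_t(g)`. -/
def mart (P : ℝ → X → Measure X) (g : X → ℝ) (Φ : ℝ → Ω → X) (t : ℝ) (ω : Ω) : ℝ :=
  corrector P g (Φ t ω) - corrector P g (Φ 0 ω) + addFun g Φ t ω

/-- The martingale increments `Z_n(g) = M_n(g) - M_{n-1}(g)`. -/
def incr (P : ℝ → X → Measure X) (g : X → ℝ) (Φ : ℝ → Ω → X) (n : ℕ) (ω : Ω) : ℝ :=
  mart P g Φ (n : ℝ) ω - mart P g Φ ((n : ℝ) - 1) ω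

/-- Truncation `a ∧ p` for `p ∈ ℕ ∪ {∞}`, with the convention `a ∧ ∞ = a`. -/
def truncMin (a : ℝ) (p : ℕ∞) : ℝ :=
  if p = ⊤ then a else min a (p.toNat : ℝ)

set_option linter.unusedSectionVars false

/-- The semigroup, cut off at negative times, as a kernel on `ℝ × X`. -/
def semiKernel (P : ℝ → X → Measure X) (hP : IsMarkovSemigroup P) :
    ProbabilityTheory.Kernel (ℝ × X) X where
  toFun p := P (max p.1 0) p.2
  measurable' := by
    refine Measure.measurable_of_measurable_coe _ fun s hs => ?_
    exact (hP.jointMeas s hs).comp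
      ((measurable_fst.max measurable_const).prodMk measurable_snd)

lemma measurable_funAct_joint {P : ℝ → X → Measure X} (hP : IsMarkovSemigroup P)
    {f : X → ℝ} (hf : Measurable f) :
    Measurable fun p : ℝ × X => funAct P (max p.1 0) f p.2 :=
  (hf.stronglyMeasurable.integral_kernel (κ := semiKernel P hP)).measurable

lemma measurable_funAct {P : ℝ → X → Measure X} (hP : IsMarkovSemigroup P)
    {f : X → ℝ} (hf : Measurable f) {t : ℝ} (ht : 0 ≤ t) : Measurable (funAct P t f) := by
  have := (measurable_funAct_joint hP hf).comp (measurable_prodMk_left (x := t))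
  simpa [Function.comp_def, max_eq_left ht] using this

lemma measurable_P {P : ℝ → X → Measure X} (hP : IsMarkovSemigroup P) (t : ℝ) :
    Measurable (P t) :=
  Measure.measurable_of_measurable_coe _ fun s hs =>
    (hP.jointMeas s hs).comp measurable_prodMk_left

lemma integrable_of_bdd {α : Type*} [MeasurableSpace α] {ν : Measure α} [IsFiniteMeasure ν]
    {f : α → ℝ} (hf : Measurable f) {C : ℝ} (hC : ∀ x, |f x| ≤ C) : Integrable f ν :=
  Integrable.of_bound hf.aestronglyMeasurable C (.of_forall hC)

lemma funAct_bdd {P : ℝ → X → Measure X} (hP : IsMarkovSemigroup P)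
    {f : X → ℝ} {C : ℝ} (hC : ∀ x, |f x| ≤ C) {t : ℝ} (ht : 0 ≤ t) (x : X) :
    |funAct P t f x| ≤ C := by
  have := hP.prob t ht x
  have h := norm_integral_le_of_norm_le_const (μ := P t x) (f := f) (C := C) (.of_forall hC)
  simpa [funAct] using h

lemma integral_funAct {P : ℝ → X → Measure X} (hP : IsMarkovSemigroup P)
    {f : X → ℝ} (hf : Measurable f) {C : ℝ} (hC : ∀ x, |f x| ≤ C) {t : ℝ} (ht : 0 ≤ t)
    (ν : Measure X) [IsProbabilityMeasure ν] :
    ∫ x, funAct P t f x ∂ν = ∫ x, f x ∂(measAct P t ν) := by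
  let κ : ProbabilityTheory.Kernel X X := ⟨P t, measurable_P hP t⟩
  have : ProbabilityTheory.IsMarkovKernel κ := ⟨fun x => hP.prob t ht x⟩
  have h : Integrable f ((κ.comp (ProbabilityTheory.Kernel.const Unit ν)) ()) :=
    integrable_of_bdd hf hC
  have h2 := ProbabilityTheory.Kernel.integral_comp h
  rw [← Measure.comp_eq_comp_const_apply] at h2
  exact h2.symm

lemma firstMoment {P : ℝ → X → Measure X} (hP : IsMarkovSemigroup P) {γ : ℝ}
    (hA3 : CondA3 P γ) {t : ℝ} (ht : 0 ≤ t) (x : X) : FiniteFirstMoment (P t x) := by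
  have hd : FiniteFirstMoment (Measure.dirac x) := fun y =>
    integrable_dirac (by simp)
  rcases ht.eq_or_lt with rfl | h
  · rw [hP.init]; exact hd
  · have := hA3.1 (Measure.dirac x) inferInstance hd t h
    rwa [measAct, Measure.dirac_bind (measurable_P hP t)] at this

lemma integrable_lip {ν : Measure X} [IsProbabilityMeasure ν] (hν : FiniteFirstMoment ν)
    {f : X → ℝ} (hf : LipschitzWith 1 f) : Integrable f ν := by
  by_cases hX : Nonempty X
  · obtain ⟨x⟩ := hX
    refine Integrable.mono' ((hν x).add (integrable_const |f x|))
      hf.continuous.measurable.aestronglyMeasurable (.of_forall fun y => ?_)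
    have h := hf.dist_le_mul y x
    rw [Real.dist_eq, dist_comm] at h
    simp only [NNReal.coe_one, one_mul] at h
    have := abs_sub_abs_le_abs_sub (f y) (f x)
    simp only [Pi.add_apply, Real.norm_eq_abs]
    linarith
  · have := not_nonempty_iff.1 hX
    exact Integrable.of_finite

lemma contraction_one {P : ℝ → X → Measure X} (hP : IsMarkovSemigroup P) {γ : ℝ}
    (hA3 : CondA3 P γ) {t : ℝ} (ht : 0 ≤ t) {f : X → ℝ} (hf : LipschitzWith 1 f) (x y : X) :
    |funAct P t f x - funAct P t f y| ≤ Real.exp (-γ * t) * dist x y := by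
  refine le_trans ?_ (hA3.2.2 t ht x y)
  refine le_csSup ?_ ⟨f, hf, rfl⟩
  have h1 := firstMoment hP hA3 ht x
  have h2 := firstMoment hP hA3 ht y
  have := hP.prob t ht x
  have := hP.prob t ht y
  refine ⟨(∫ z, dist x z ∂(P t x)) + ∫ z, dist x z ∂(P t y), ?_⟩
  rintro _ ⟨k, hk, rfl⟩
  have key : ∀ ν : Measure X, IsProbabilityMeasure ν → FiniteFirstMoment ν →
      |(∫ z, k z ∂ν) - k x| ≤ ∫ z, dist x z ∂ν := by
    intro ν _ hν
    have : (∫ z, k z ∂ν) - k x = ∫ z, (k z - k x) ∂ν := by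
      rw [integral_sub (integrable_lip hν hk) (integrable_const _)]; simp
    rw [this, ← Real.norm_eq_abs]
    refine norm_integral_le_of_norm_le (hν x) (.of_forall fun z => ?_)
    have h := hk.dist_le_mul z x
    rw [dist_comm z x] at h
    simpa [Real.dist_eq] using h
  have a := key _ ‹_› h1
  have b := key _ ‹_› h2
  rw [abs_le] at *
  constructor <;> linarith [a.1, a.2, b.1, b.2]

lemma contraction {P : ℝ → X → Measure X} (hP : IsMarkovSemigroup P) {γ : ℝ}
    (hA3 : CondA3 P γ) {t : ℝ} (ht : 0 ≤ t) {f : X → ℝ} {L : ℝ} (hL : 0 < L)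
    (hf : ∀ x y, |f x - f y| ≤ L * dist x y) (x y : X) :
    |funAct P t f x - funAct P t f y| ≤ L * Real.exp (-γ * t) * dist x y := by
  have h1 : LipschitzWith 1 (fun z => L⁻¹ * f z) := by
    refine LipschitzWith.of_dist_le_mul fun a b => ?_
    rw [Real.dist_eq, ← mul_sub, abs_mul, abs_of_pos (inv_pos.2 hL), inv_mul_le_iff₀ hL]
    simpa using hf a b
  have h2 := contraction_one hP hA3 ht h1 x y
  unfold funAct at *
  rw [integral_const_mul, integral_const_mul, ← mul_sub, abs_mul, abs_of_pos (inv_pos.2 hL),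
    inv_mul_le_iff₀ hL] at h2
  linarith

lemma exp_tendsto {γ : ℝ} (hγ : 0 < γ) : Tendsto (fun t => Real.exp (-γ * t)) atTop (𝓝 0) := by
  refine Real.tendsto_exp_atBot.comp ?_
  exact tendsto_id.const_mul_atTop_of_neg (by linarith)

lemma conv_pt {P : ℝ → X → Measure X} (hP : IsMarkovSemigroup P) {γ : ℝ}
    (hA3 : CondA3 P γ) {μstar : Measure X} [IsProbabilityMeasure μstar]
    (hinv : ∀ t, 0 ≤ t → measAct P t μstar = μstar)
    {f : X → ℝ} {L C : ℝ} (hL : 0 < L) (hm : Measurable f)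
    (hf : ∀ x y, |f x - f y| ≤ L * dist x y) (hC : ∀ x, |f x| ≤ C) (x : X) :
    Tendsto (fun t => funAct P t f x) atTop (𝓝 (∫ y, f y ∂μstar)) := by
  rw [← tendsto_sub_nhds_zero_iff]
  have h : Tendsto (fun t => ∫ y, (funAct P t f x - funAct P t f y) ∂μstar) atTop
      (𝓝 (∫ _, (0:ℝ) ∂μstar)) := by
    refine tendsto_integral_filter_of_dominated_convergence (fun _ => C + C) ?_ ?_
      (integrable_const _) (.of_forall fun y => ?_)
    · filter_upwards [eventually_ge_atTop 0] with t ht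
      exact (measurable_const.sub (measurable_funAct hP hm ht)).aestronglyMeasurable
    · filter_upwards [eventually_ge_atTop 0] with t ht
      refine .of_forall fun y => ?_
      exact (abs_sub _ _).trans (add_le_add (funAct_bdd hP hC ht x) (funAct_bdd hP hC ht y))
    · have h0 : Tendsto (fun t => L * Real.exp (-γ * t) * dist x y) atTop (𝓝 0) := by
        simpa using ((exp_tendsto hA3.2.1).const_mul L).mul_const (dist x y)
      refine squeeze_zero_norm' ?_ h0
      filter_upwards [eventually_ge_atTop 0] with t ht
      exact contraction hP hA3 ht hL hf x y
  rw [integral_zero] at h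
  refine h.congr' ?_
  filter_upwards [eventually_ge_atTop 0] with t ht
  rw [integral_sub (integrable_const _) (integrable_of_bdd (measurable_funAct hP hm ht)
    (funAct_bdd hP hC ht)), integral_funAct hP hm hC ht, hinv t ht]
  simp

lemma natFil_le {Φ : ℝ → Ω → X} (hj : Measurable fun p : ℝ × Ω => Φ p.1 p.2) (s : ℝ) :
    natFiltration Φ s ≤ ‹MeasurableSpace Ω› := by
  refine iSup₂_le fun u _ => ?_
  exact Measurable.comap_le (hj.comp measurable_prodMk_left)

lemma meas_Phi {Φ : ℝ → Ω → X} (hj : Measurable fun p : ℝ × Ω => Φ p.1 p.2) (s : ℝ) :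
    Measurable (Φ s) := hj.comp measurable_prodMk_left

lemma markov_two {P : ℝ → X → Measure X} (_hP : IsMarkovSemigroup P) {μ : Measure X}
    {ℙμ : Measure Ω} [IsProbabilityMeasure ℙμ] {Φ : ℝ → Ω → X}
    (hΦ : IsMarkovProcess P Φ ℙμ μ) {f k : X → ℝ} (hf : Measurable f) (hk : Measurable k)
    {C D : ℝ} (hC : ∀ x, |f x| ≤ C) (hD : ∀ x, |k x| ≤ D) {s t : ℝ} (hs : 0 ≤ s) (ht : 0 ≤ t) :
    ∫ ω, k (Φ s ω) * f (Φ (s + t) ω) ∂ℙμ = ∫ ω, k (Φ s ω) * funAct P t f (Φ s ω) ∂ℙμ := by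
  have hle := natFil_le hΦ.jointMeas s
  have h1 := hΦ.markov f hf ⟨C, hC⟩ s t hs ht
  have hm : Measurable[natFiltration Φ s] fun ω => k (Φ s ω) := by
    refine hk.comp ?_
    refine Measurable.of_comap_le ?_
    exact le_iSup₂_of_le (f := fun u (_ : u ∈ Set.Icc (0 : ℝ) s) =>
      MeasurableSpace.comap (Φ u) inferInstance) s ⟨hs, le_rfl⟩ le_rfl
  have hik : Integrable (fun ω => k (Φ s ω)) ℙμ :=
    integrable_of_bdd (hk.comp (meas_Phi hΦ.jointMeas s)) (fun ω => hD _)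
  have hif : Integrable (fun ω => f (Φ (s + t) ω)) ℙμ :=
    integrable_of_bdd (hf.comp (meas_Phi hΦ.jointMeas _)) (fun ω => hC _)
  have hprod : Integrable ((fun ω => k (Φ s ω)) * fun ω => f (Φ (s + t) ω)) ℙμ :=
    hif.bdd_mul hik.aestronglyMeasurable (.of_forall fun ω => hD _)
  have h2 := condExp_mul_of_stronglyMeasurable_left hm.stronglyMeasurable hprod hif
  have h3 := integral_condExp hle (μ := ℙμ) (f := (fun ω => k (Φ s ω)) * fun ω => f (Φ (s + t) ω))
  rw [show (∫ ω, k (Φ s ω) * f (Φ (s + t) ω) ∂ℙμ) =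
    ∫ ω, ((fun ω => k (Φ s ω)) * fun ω => f (Φ (s + t) ω)) ω ∂ℙμ from rfl, ← h3]
  refine integral_congr_ae ?_
  filter_upwards [h1, h2] with ω e1 e2
  rw [e2, Pi.mul_apply, ← e1]

lemma conv_E {P : ℝ → X → Measure X} (hP : IsMarkovSemigroup P) {γ : ℝ}
    (hA3 : CondA3 P γ) {μ μstar : Measure X} [IsProbabilityMeasure μstar]
    (hinv : ∀ t, 0 ≤ t → measAct P t μstar = μstar)
    {ℙμ : Measure Ω} [IsProbabilityMeasure ℙμ] {Φ : ℝ → Ω → X}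
    (hΦ : IsMarkovProcess P Φ ℙμ μ)
    {f : X → ℝ} {L C : ℝ} (hL : 0 < L) (hm : Measurable f)
    (hf : ∀ x y, |f x - f y| ≤ L * dist x y) (hC : ∀ x, |f x| ≤ C) :
    Tendsto (fun t => ∫ ω, f (Φ t ω) ∂ℙμ) atTop (𝓝 (∫ y, f y ∂μstar)) := by
  have h : Tendsto (fun t => ∫ ω, funAct P t f (Φ 0 ω) ∂ℙμ) atTop
      (𝓝 (∫ _, (∫ y, f y ∂μstar) ∂ℙμ)) := by
    refine tendsto_integral_filter_of_dominated_convergence (fun _ => C) ?_ ?_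
      (integrable_const _) (.of_forall fun ω => conv_pt hP hA3 hinv hL hm hf hC _)
    · filter_upwards [eventually_ge_atTop 0] with t ht
      exact ((measurable_funAct hP hm ht).comp (meas_Phi hΦ.jointMeas 0)).aestronglyMeasurable
    · filter_upwards [eventually_ge_atTop 0] with t ht
      exact .of_forall fun ω => funAct_bdd hP hC ht _
  simp only [integral_const, probReal_univ, one_smul] at h
  refine h.congr' ?_
  filter_upwards [eventually_ge_atTop 0] with t ht
  have := markov_two hP hΦ hm (k := fun _ => (1:ℝ)) measurable_const hC (D := 1) (by simp)
    le_rfl ht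
  simpa using this.symm

lemma moment_E {P : ℝ → X → Measure X} {μ : Measure X} {x₀ : X} {ζ : ℝ}
    (hA4 : CondA4 P μ x₀ ζ) {ℙμ : Measure Ω} [IsProbabilityMeasure ℙμ] {Φ : ℝ → Ω → X}
    (hΦ : IsMarkovProcess P Φ ℙμ μ) :
    ∃ A : ℝ, 0 ≤ A ∧ ∀ t, 0 ≤ t → Integrable (fun ω => dist x₀ (Φ t ω) ^ 2) ℙμ ∧
      ∫ ω, dist x₀ (Φ t ω) ^ 2 ∂ℙμ ≤ A := by
  obtain ⟨hζ, M, hM⟩ := hA4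
  refine ⟨(1 + ENNReal.ofReal M).toReal, ENNReal.toReal_nonneg, fun t ht => ?_⟩
  have hmeas : Measurable (fun ω => dist x₀ (Φ t ω)) :=
    measurable_const.dist (meas_Phi hΦ.jointMeas t)
  have hl : ∫⁻ ω, ENNReal.ofReal (dist x₀ (Φ t ω) ^ 2) ∂ℙμ ≤ 1 + ENNReal.ofReal M := by
    have h1 := hM t ht
    rw [← hΦ.law t ht, lintegral_map (by fun_prop) (meas_Phi hΦ.jointMeas t)] at h1
    calc ∫⁻ ω, ENNReal.ofReal (dist x₀ (Φ t ω) ^ 2) ∂ℙμ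
        ≤ ∫⁻ ω, (1 + ENNReal.ofReal (dist x₀ (Φ t ω) ^ ζ)) ∂ℙμ := by
          refine lintegral_mono fun ω => ?_
          rw [← ENNReal.ofReal_one, ← ENNReal.ofReal_add zero_le_one (by positivity)]
          refine ENNReal.ofReal_le_ofReal ?_
          rcases le_total (dist x₀ (Φ t ω)) 1 with h | h
          · have : dist x₀ (Φ t ω) ^ 2 ≤ 1 := pow_le_one₀ dist_nonneg h
            have : 0 ≤ dist x₀ (Φ t ω) ^ ζ := by positivity
            linarith
          · have := Real.rpow_le_rpow_of_exponent_le h hζ.le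
            rw [Real.rpow_two] at this
            linarith
      _ = 1 + ∫⁻ ω, ENNReal.ofReal (dist x₀ (Φ t ω) ^ ζ) ∂ℙμ := by
          rw [lintegral_add_left measurable_const]; simp
      _ ≤ _ := by gcongr
  have hfin : (1 + ENNReal.ofReal M) ≠ ⊤ := by finiteness
  refine ⟨⟨(hmeas.pow_const 2).aestronglyMeasurable, ?_⟩, ?_⟩
  · rw [hasFiniteIntegral_iff_ofReal (.of_forall fun ω => by positivity)]
    exact hl.trans_lt hfin.lt_top
  · rw [integral_eq_lintegral_of_nonneg_ae (.of_forall fun ω => by positivity)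
      (hmeas.pow_const 2).aestronglyMeasurable]
    exact ENNReal.toReal_mono hfin hl

lemma moment_star {P : ℝ → X → Measure X} (hP : IsMarkovSemigroup P) {γ : ℝ}
    (hA3 : CondA3 P γ) {μ μstar : Measure X} [IsProbabilityMeasure μstar]
    (hinv : ∀ t, 0 ≤ t → measAct P t μstar = μstar) {x₀ : X} {ζ : ℝ}
    (hA4 : CondA4 P μ x₀ ζ)
    {ℙμ : Measure Ω} [IsProbabilityMeasure ℙμ] {Φ : ℝ → Ω → X}
    (hΦ : IsMarkovProcess P Φ ℙμ μ) :
    Integrable (fun x => dist x₀ x ^ 2) μstar := by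
  obtain ⟨A, hA0, hA⟩ := moment_E hA4 hΦ
  have hV : Measurable fun x : X => dist x₀ x := by fun_prop
  have hf : ∀ N : ℕ, ∫ x, (min (dist x₀ x) N) ^ 2 ∂μstar ≤ A := by
    intro N
    have hm : Measurable fun x : X => (min (dist x₀ x) (N : ℝ)) ^ 2 := by fun_prop
    have hb : ∀ x : X, 0 ≤ min (dist x₀ x) (N : ℝ) := fun x => le_min dist_nonneg (by positivity)
    have hb' : ∀ x : X, min (dist x₀ x) (N : ℝ) ≤ N := fun x => min_le_right _ _
    have hc : Tendsto (fun t => ∫ ω, (min (dist x₀ (Φ t ω)) (N : ℝ)) ^ 2 ∂ℙμ) atTop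
        (𝓝 (∫ x, (min (dist x₀ x) N) ^ 2 ∂μstar)) := by
      refine conv_E hP hA3 hinv hΦ (f := fun x : X => (min (dist x₀ x) (N : ℝ)) ^ 2)
        (L := 2 * N + 1) (C := N ^ 2) (by positivity) hm ?_ ?_
      · intro x y
        have h1 : |min (dist x₀ x) (N : ℝ) - min (dist x₀ y) (N : ℝ)| ≤ dist x y := by
          refine (abs_min_sub_min_le_max _ _ _ _).trans ?_
          simp only [sub_self, abs_zero]
          refine max_le ?_ dist_nonneg
          rw [dist_comm x₀ x, dist_comm x₀ y]
          exact abs_dist_sub_le x y x₀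
        rw [sq_sub_sq, abs_mul]
        have h2 : |min (dist x₀ x) (N : ℝ) + min (dist x₀ y) (N : ℝ)| ≤ 2 * N + 1 := by
          rw [abs_of_nonneg (add_nonneg (hb x) (hb y))]
          linarith [hb' x, hb' y]
        exact mul_le_mul h2 h1 (abs_nonneg _) (by positivity)
      · intro x
        rw [abs_of_nonneg (by positivity)]
        exact pow_le_pow_left₀ (hb x) (hb' x) 2
    refine le_of_tendsto hc ?_
    filter_upwards [eventually_ge_atTop 0] with t ht
    refine le_trans (integral_mono_of_nonneg (.of_forall fun ω => by positivity) (hA t ht).1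
      (.of_forall fun ω => ?_)) (hA t ht).2
    exact pow_le_pow_left₀ (hb _) (min_le_left _ _) 2
  refine ⟨(hV.pow_const 2).aestronglyMeasurable, ?_⟩
  rw [hasFiniteIntegral_iff_ofReal (.of_forall fun ω => by positivity)]
  have hlim : ∀ x : X, Tendsto (fun N : ℕ => ENNReal.ofReal ((min (dist x₀ x) (N : ℝ)) ^ 2)) atTop
      (𝓝 (ENNReal.ofReal (dist x₀ x ^ 2))) := by
    intro x
    refine tendsto_const_nhds.congr' ?_
    obtain ⟨N, hN⟩ := exists_nat_ge (dist x₀ x)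
    filter_upwards [eventually_ge_atTop N] with n hn
    rw [min_eq_left (hN.trans (by exact_mod_cast hn))]
  have hfatou : ∫⁻ x, ENNReal.ofReal (dist x₀ x ^ 2) ∂μstar ≤ ENNReal.ofReal A := by
    calc ∫⁻ x, ENNReal.ofReal (dist x₀ x ^ 2) ∂μstar
        = ∫⁻ x, liminf (fun N : ℕ => ENNReal.ofReal ((min (dist x₀ x) (N : ℝ)) ^ 2)) atTop
            ∂μstar := lintegral_congr fun x => (hlim x).liminf_eq.symm
      _ ≤ liminf (fun N : ℕ => ∫⁻ x, ENNReal.ofReal ((min (dist x₀ x) (N : ℝ)) ^ 2) ∂μstar)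
            atTop := lintegral_liminf_le fun N => by fun_prop
      _ ≤ liminf (fun _ : ℕ => ENNReal.ofReal A) atTop := by
          refine liminf_le_liminf (.of_forall fun N => ?_)
          rw [← ofReal_integral_eq_lintegral_ofReal]
          · exact ENNReal.ofReal_le_ofReal (hf N)
          · refine integrable_of_bdd (C := N ^ 2) (by fun_prop) fun x => ?_
            rw [abs_of_nonneg (by positivity)]
            exact pow_le_pow_left₀ (le_min dist_nonneg (by positivity)) (min_le_right _ _) 2
          · exact .of_forall fun x => by positivity
      _ = _ := by simp
  exact hfatou.trans_lt ENNReal.ofReal_lt_top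

lemma integrable_of_sq {α : Type*} [MeasurableSpace α] {ν : Measure α} [IsFiniteMeasure ν]
    {f : α → ℝ} (hf : Measurable f) (h : Integrable (fun x => f x ^ 2) ν) : Integrable f ν := by
  refine Integrable.mono' (h.add (integrable_const 1)) hf.aestronglyMeasurable
    (.of_forall fun x => ?_)
  simp only [Real.norm_eq_abs, Pi.add_apply]
  rcases abs_cases (f x) with ⟨h, _⟩ | ⟨h, _⟩ <;> rw [h] <;> nlinarith [sq_nonneg (f x - 1), sq_nonneg (f x + 1)]

/-- Exponential decay of `P_t g`. -/
lemma decay {P : ℝ → X → Measure X} (hP : IsMarkovSemigroup P) {γ : ℝ}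
    (hA3 : CondA3 P γ) {μstar : Measure X} [IsProbabilityMeasure μstar]
    (hinv : ∀ t, 0 ≤ t → measAct P t μstar = μstar) {x₀ : X}
    (hV : Integrable (fun x => dist x₀ x ^ 2) μstar)
    {g : X → ℝ} {L C : ℝ} (hL : 0 < L) (hm : Measurable g)
    (hg : ∀ x y, |g x - g y| ≤ L * dist x y) (hC : ∀ x, |g x| ≤ C)
    (hmean : ∫ x, g x ∂μstar = 0) {t : ℝ} (ht : 0 ≤ t) (x : X) :
    |funAct P t g x| ≤ L * Real.exp (-γ * t) * (dist x₀ x + ∫ y, dist x₀ y ∂μstar) := by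
  have hV1 : Integrable (fun x => dist x₀ x) μstar :=
    integrable_of_sq (by fun_prop) hV
  have h1 : funAct P t g x = ∫ y, (funAct P t g x - funAct P t g y) ∂μstar := by
    rw [integral_sub (integrable_const _) (integrable_of_bdd (measurable_funAct hP hm ht)
      (funAct_bdd hP hC ht)), integral_funAct hP hm hC ht, hinv t ht, hmean]
    simp
  have h2 : Integrable (fun y => L * Real.exp (-γ * t) * (dist x₀ x + dist x₀ y)) μstar :=
    ((integrable_const _).add hV1).const_mul _
  have h3 : |∫ y, (funAct P t g x - funAct P t g y) ∂μstar| ≤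
      ∫ y, L * Real.exp (-γ * t) * (dist x₀ x + dist x₀ y) ∂μstar := by
    rw [← Real.norm_eq_abs]
    refine norm_integral_le_of_norm_le h2 (.of_forall fun y => ?_)
    refine (contraction hP hA3 ht hL hg x y).trans ?_
    gcongr
    rw [dist_comm x₀ x]
    exact dist_triangle _ _ _
  rw [← h1] at h3
  refine h3.trans_eq ?_
  rw [integral_const_mul, integral_add (integrable_const _) hV1]
  simp

lemma exp_int {γ : ℝ} (hγ : 0 < γ) (c : ℝ) :
    ∫ t in Set.Ioi c, Real.exp (-γ * t) = Real.exp (-γ * c) / γ := by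
  rw [integral_exp_mul_Ioi (by linarith)]
  field_simp

lemma corrector_integrable {P : ℝ → X → Measure X} (hP : IsMarkovSemigroup P) {γ : ℝ}
    (hγ : 0 < γ) {g : X → ℝ} (hm : Measurable g) {L : ℝ} {W : X → ℝ}
    (hd : ∀ t, 0 ≤ t → ∀ x, |funAct P t g x| ≤ L * Real.exp (-γ * t) * W x) (x : X) :
    IntegrableOn (fun t => funAct P t g x) (Set.Ioi 0) := by
  have h1 : IntegrableOn (fun t => L * Real.exp (-γ * t) * W x) (Set.Ioi 0) :=
    ((integrableOn_exp_mul_Ioi (by linarith) 0).const_mul L).mul_const _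
  refine Integrable.mono' h1 ?_ ?_
  · have h2 : Measurable fun t : ℝ => funAct P (max t 0) g x :=
      (measurable_funAct_joint hP hm).comp measurable_prodMk_right
    refine h2.aestronglyMeasurable.congr ?_
    filter_upwards [ae_restrict_mem measurableSet_Ioi] with t ht
    rw [max_eq_left (le_of_lt ht)]
  · filter_upwards [ae_restrict_mem measurableSet_Ioi] with t ht
    exact hd t (le_of_lt ht) x

lemma corrector_measurable {P : ℝ → X → Measure X} (hP : IsMarkovSemigroup P)
    {g : X → ℝ} (hm : Measurable g) : Measurable (corrector P g) := by
  have h1 : StronglyMeasurable fun x =>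
      ∫ t in Set.Ioi (0 : ℝ), funAct P (max t 0) g x :=
    StronglyMeasurable.integral_prod_left' (f := fun p : ℝ × X => funAct P (max p.1 0) g p.2)
      (measurable_funAct_joint hP hm).stronglyMeasurable
  have h2 : corrector P g = fun x => ∫ t in Set.Ioi (0 : ℝ), funAct P (max t 0) g x := by
    funext x
    refine setIntegral_congr_fun measurableSet_Ioi fun t ht => ?_
    simp only [max_eq_left (le_of_lt (Set.mem_Ioi.1 ht))]
  rw [h2]
  exact h1.measurable

lemma corrector_bound {P : ℝ → X → Measure X} {γ : ℝ}
    (hγ : 0 < γ) {g : X → ℝ} {L : ℝ} {W : X → ℝ}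
    (hd : ∀ t, 0 ≤ t → ∀ x, |funAct P t g x| ≤ L * Real.exp (-γ * t) * W x) (x : X) :
    |corrector P g x| ≤ L / γ * W x := by
  have h1 : IntegrableOn (fun t => L * Real.exp (-γ * t) * W x) (Set.Ioi 0) :=
    ((integrableOn_exp_mul_Ioi (by linarith) 0).const_mul L).mul_const _
  have h2 : |corrector P g x| ≤ ∫ t in Set.Ioi (0 : ℝ), L * Real.exp (-γ * t) * W x := by
    rw [← Real.norm_eq_abs]
    refine norm_integral_le_of_norm_le h1 ?_
    filter_upwards [ae_restrict_mem measurableSet_Ioi] with t ht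
    exact hd t (le_of_lt ht) x
  refine h2.trans_eq ?_
  rw [integral_mul_const, integral_const_mul, exp_int hγ]
  rw [mul_zero, Real.exp_zero]
  ring

lemma corrector_lip {P : ℝ → X → Measure X} (hP : IsMarkovSemigroup P) {γ : ℝ}
    (hA3 : CondA3 P γ) {g : X → ℝ} (hm : Measurable g) {L : ℝ} (hL : 0 < L) {W : X → ℝ}
    (hg : ∀ x y, |g x - g y| ≤ L * dist x y)
    (hd : ∀ t, 0 ≤ t → ∀ x, |funAct P t g x| ≤ L * Real.exp (-γ * t) * W x) (x y : X) :
    |corrector P g x - corrector P g y| ≤ L / γ * dist x y := by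
  have hγ := hA3.2.1
  have h1 : IntegrableOn (fun t => L * Real.exp (-γ * t) * dist x y) (Set.Ioi 0) :=
    ((integrableOn_exp_mul_Ioi (by linarith) 0).const_mul L).mul_const _
  unfold corrector
  rw [← integral_sub (corrector_integrable hP hγ hm hd x) (corrector_integrable hP hγ hm hd y)]
  have h2 : |∫ t in Set.Ioi (0 : ℝ), (funAct P t g x - funAct P t g y)|
      ≤ ∫ t in Set.Ioi (0 : ℝ), L * Real.exp (-γ * t) * dist x y := by
    rw [← Real.norm_eq_abs]
    refine norm_integral_le_of_norm_le h1 ?_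
    filter_upwards [ae_restrict_mem measurableSet_Ioi] with t ht
    exact contraction hP hA3 (le_of_lt ht) hL hg x y
  refine h2.trans_eq ?_
  rw [integral_mul_const, integral_const_mul, exp_int hγ]
  rw [mul_zero, Real.exp_zero]
  ring

/-- Truncation to `[-N, N]`. -/
def clampN (N : ℝ) (a : ℝ) : ℝ := max (-N) (min a N)

lemma clampN_abs {N : ℝ} (hN : 0 < N) (a : ℝ) : |clampN N a| ≤ N := by
  unfold clampN
  rw [abs_le]
  exact ⟨le_max_left _ _, max_le (by linarith) (min_le_right _ _)⟩

lemma clampN_lip {N : ℝ} (a b : ℝ) : |clampN N a - clampN N b| ≤ |a - b| := by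
  unfold clampN
  refine (abs_max_sub_max_le_max _ _ _ _).trans ?_
  refine max_le (by simp) ((abs_min_sub_min_le_max _ _ _ _).trans (max_le le_rfl (by simp)))

lemma clampN_err {N : ℝ} (hN : 0 < N) (a : ℝ) : |a - clampN N a| ≤ a ^ 2 / N := by
  unfold clampN
  rw [le_div_iff₀ hN]
  rcases le_total a N with h | h
  · rw [min_eq_left h]
    rcases le_total (-N) a with h' | h'
    · rw [max_eq_right h']; simp; positivity
    · rw [max_eq_left h', abs_of_nonpos (by linarith)]; nlinarith
  · rw [min_eq_right h, max_eq_right (by linarith), abs_of_nonneg (by linarith)]; nlinarith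

lemma trunc_err {α : Type*} [MeasurableSpace α] {ν : Measure α} [IsProbabilityMeasure ν]
    {a b : α → ℝ} (ha : Measurable a) (hb : Measurable b) {C B N : ℝ} (hC0 : 0 ≤ C)
    (hN : 0 < N) (hC : ∀ x, |a x| ≤ C) (hb2 : Integrable (fun x => b x ^ 2) ν)
    (hB : ∫ x, b x ^ 2 ∂ν ≤ B) :
    |(∫ x, a x * b x ∂ν) - ∫ x, a x * clampN N (b x) ∂ν| ≤ C * B / N := by
  have hib : Integrable b ν := integrable_of_sq hb hb2
  have h1 : Integrable (fun x => a x * b x) ν :=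
    hib.bdd_mul ha.aestronglyMeasurable (.of_forall hC)
  have hcm : Measurable fun x => clampN N (b x) := by unfold clampN; fun_prop
  have h2 : Integrable (fun x => a x * clampN N (b x)) ν :=
    (integrable_of_bdd hcm (fun x => clampN_abs hN _)).bdd_mul ha.aestronglyMeasurable
      (.of_forall hC)
  rw [← integral_sub h1 h2]
  have h3 : |∫ x, (a x * b x - a x * clampN N (b x)) ∂ν| ≤ ∫ x, C / N * b x ^ 2 ∂ν := by
    rw [← Real.norm_eq_abs]
    refine norm_integral_le_of_norm_le (hb2.const_mul _) (.of_forall fun x => ?_)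
    rw [← mul_sub, Real.norm_eq_abs, abs_mul]
    calc |a x| * |b x - clampN N (b x)| ≤ C * (b x ^ 2 / N) :=
          mul_le_mul (hC x) (clampN_err hN _) (abs_nonneg _) hC0
      _ = _ := by ring
  refine h3.trans ?_
  rw [integral_const_mul]
  calc C / N * ∫ x, b x ^ 2 ∂ν ≤ C / N * B := by gcongr
    _ = _ := by ring

lemma conv_chi {P : ℝ → X → Measure X} (hP : IsMarkovSemigroup P) {γ : ℝ}
    (hA3 : CondA3 P γ) {μ μstar : Measure X} [IsProbabilityMeasure μstar]
    (hinv : ∀ t, 0 ≤ t → measAct P t μstar = μstar)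
    {ℙμ : Measure Ω} [IsProbabilityMeasure ℙμ] {Φ : ℝ → Ω → X}
    (hΦ : IsMarkovProcess P Φ ℙμ μ)
    {g k : X → ℝ} {L C L' B : ℝ} (hL : 0 < L) (hL' : 0 ≤ L') (hC0 : 0 ≤ C) (hm : Measurable g)
    (hg : ∀ x y, |g x - g y| ≤ L * dist x y) (hC : ∀ x, |g x| ≤ C)
    (hk : Measurable k) (hkl : ∀ x y, |k x - k y| ≤ L' * dist x y)
    (hks : Integrable (fun x => k x ^ 2) μstar) (hksB : ∫ x, k x ^ 2 ∂μstar ≤ B)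
    (hkE : ∀ t, 0 ≤ t → Integrable (fun ω => k (Φ t ω) ^ 2) ℙμ ∧ ∫ ω, k (Φ t ω) ^ 2 ∂ℙμ ≤ B) :
    Tendsto (fun t => ∫ ω, g (Φ t ω) * k (Φ t ω) ∂ℙμ) atTop (𝓝 (∫ y, g y * k y ∂μstar)) := by
  have hB0 : 0 ≤ B := le_trans (integral_nonneg fun x => sq_nonneg _) hksB
  rw [Metric.tendsto_atTop']
  intro ε hε
  obtain ⟨N, hN, hNε⟩ : ∃ N : ℝ, 0 < N ∧ C * B / N < ε / 3 := by
    refine ⟨(C * B + 1) / (ε / 3), by positivity, ?_⟩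
    rw [div_lt_iff₀ (by positivity)]
    rw [mul_div_cancel₀ _ (by positivity)]
    linarith
  have hcl : Measurable fun x => clampN N (k x) := by unfold clampN; fun_prop
  have hc : Tendsto (fun t => ∫ ω, g (Φ t ω) * clampN N (k (Φ t ω)) ∂ℙμ) atTop
      (𝓝 (∫ y, g y * clampN N (k y) ∂μstar)) := by
    refine conv_E hP hA3 hinv hΦ (f := fun x => g x * clampN N (k x)) (L := L * N + C * L')
      (C := C * N) (by positivity) (hm.mul hcl) ?_ ?_
    · intro x y
      have e : g x * clampN N (k x) - g y * clampN N (k y) =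
        (g x - g y) * clampN N (k x) + g y * (clampN N (k x) - clampN N (k y)) := by ring
      rw [e]
      refine (abs_add_le _ _).trans ?_
      rw [abs_mul, abs_mul]
      have h1 := mul_le_mul (hg x y) (clampN_abs hN (k x)) (abs_nonneg _) (by positivity)
      have h2 := mul_le_mul (hC y) ((clampN_lip (N := N) (k x) (k y)).trans (hkl x y))
        (abs_nonneg _) hC0
      linarith
    · intro x
      rw [abs_mul]
      exact mul_le_mul (hC x) (clampN_abs hN _) (abs_nonneg _) hC0
  rw [Metric.tendsto_atTop'] at hc
  obtain ⟨T, hT⟩ := hc (ε / 3) (by positivity)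
  refine ⟨max T 0, fun t ht => ?_⟩
  have ht0 : 0 ≤ t := ((le_max_right _ _).trans_lt ht).le
  have e1 := hT t ((le_max_left _ _).trans_lt ht)
  have e2 := trunc_err (ν := ℙμ) (hm.comp (meas_Phi hΦ.jointMeas t))
    (hk.comp (meas_Phi hΦ.jointMeas t)) hC0 hN (fun ω => hC _) (hkE t ht0).1 (hkE t ht0).2
  have e3 := trunc_err (ν := μstar) hm hk hC0 hN hC hks hksB
  simp only [Function.comp_apply] at e2
  rw [Real.dist_eq] at *
  rw [abs_lt] at *
  rw [abs_le] at e2 e3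
  constructor <;> linarith [e1.1, e1.2, e2.1, e2.2, e3.1, e3.2]

/-- Upper-triangular part of the covariance integral. -/
def triW (a : ℝ → Ω → ℝ) (ℙμ : Measure Ω) (n s : ℝ) : ℝ :=
  ∫ u in Set.Ioc 0 n, if s < u then ∫ ω, a s ω * a u ω ∂ℙμ else 0

lemma cov_meas {ℙμ : Measure Ω} [IsProbabilityMeasure ℙμ] {a : ℝ → Ω → ℝ}
    (ha : Measurable fun p : ℝ × Ω => a p.1 p.2) :
    Measurable fun p : ℝ × ℝ => ∫ ω, a p.1 ω * a p.2 ω ∂ℙμ := by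
  have h : Measurable fun q : (ℝ × ℝ) × Ω => a q.1.1 q.2 * a q.1.2 q.2 :=
    (ha.comp ((measurable_fst.comp measurable_fst).prodMk measurable_snd)).mul
      (ha.comp ((measurable_snd.comp measurable_fst).prodMk measurable_snd))
  exact (h.stronglyMeasurable.integral_prod_right' (ν := ℙμ)).measurable

lemma triW_meas {ℙμ : Measure Ω} [IsProbabilityMeasure ℙμ] {a : ℝ → Ω → ℝ}
    (ha : Measurable fun p : ℝ × Ω => a p.1 p.2) (n : ℝ) : Measurable (triW a ℙμ n) := by
  have h : Measurable fun p : ℝ × ℝ => if p.1 < p.2 then ∫ ω, a p.1 ω * a p.2 ω ∂ℙμ else 0 :=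
    Measurable.ite (measurableSet_lt measurable_fst measurable_snd) (cov_meas ha) measurable_const
  exact (h.stronglyMeasurable.integral_prod_right'
    (ν := (volume : Measure ℝ).restrict (Set.Ioc 0 n))).measurable

lemma second_moment_tri {ℙμ : Measure Ω} [IsProbabilityMeasure ℙμ] {a : ℝ → Ω → ℝ}
    (ha : Measurable fun p : ℝ × Ω => a p.1 p.2) {C : ℝ} (hC0 : 0 ≤ C)
    (hC : ∀ s ω, |a s ω| ≤ C) (n : ℝ) :
    ∫ ω, (∫ s in Set.Ioc 0 n, a s ω) ^ 2 ∂ℙμ = 2 * ∫ s in Set.Ioc 0 n, triW a ℙμ n s := by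
  set ν : Measure ℝ := (volume : Measure ℝ).restrict (Set.Ioc 0 n) with hν
  have : IsFiniteMeasure ν := ⟨by simp [hν]⟩
  set c : ℝ × ℝ → ℝ := fun p => ∫ ω, a p.1 ω * a p.2 ω ∂ℙμ with hc
  have hcm : Measurable c := cov_meas ha
  have hab : ∀ s u ω, |a s ω * a u ω| ≤ C * C := fun s u ω => by
    rw [abs_mul]; exact mul_le_mul (hC s ω) (hC u ω) (abs_nonneg _) hC0
  have hcb : ∀ p, |c p| ≤ C * C := fun p => by
    have h := norm_integral_le_of_norm_le_const (μ := ℙμ)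
      (f := fun ω => a p.1 ω * a p.2 ω) (C := C * C) (.of_forall (hab p.1 p.2))
    simpa [hc] using h
  have hsym : ∀ s u, c (s, u) = c (u, s) := fun s u => by
    simp only [hc, mul_comm]
  have h1 : ∫ ω, (∫ s in Set.Ioc 0 n, a s ω) ^ 2 ∂ℙμ = ∫ p, c p ∂(ν.prod ν) := by
    have e : ∀ ω, (∫ s in Set.Ioc 0 n, a s ω) ^ 2 = ∫ p : ℝ × ℝ, a p.1 ω * a p.2 ω ∂(ν.prod ν) := by
      intro ω
      rw [sq, ← integral_prod_mul]
    simp_rw [e]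
    rw [integral_integral_swap]
    have h : Measurable fun q : Ω × (ℝ × ℝ) => a q.2.1 q.1 * a q.2.2 q.1 :=
      (ha.comp ((measurable_fst.comp measurable_snd).prodMk measurable_fst)).mul
        (ha.comp ((measurable_snd.comp measurable_snd).prodMk measurable_fst))
    exact integrable_of_bdd h (fun q => hab _ _ _)
  set d : ℝ × ℝ → ℝ := fun p => if p.1 < p.2 then c p else 0 with hd
  set e : ℝ × ℝ → ℝ := fun p => if p.1 ≤ p.2 then c p else 0 with he
  have hdi : Integrable d (ν.prod ν) := by
    refine integrable_of_bdd (C := C * C)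
      (Measurable.ite (measurableSet_lt measurable_fst measurable_snd) hcm measurable_const) ?_
    intro p
    simp only [hd]; split_ifs
    · exact hcb p
    · simp; positivity
  have hei : Integrable e (ν.prod ν) := by
    refine integrable_of_bdd (C := C * C)
      (Measurable.ite (measurableSet_le measurable_fst measurable_snd) hcm measurable_const) ?_
    intro p
    simp only [he]; split_ifs
    · exact hcb p
    · simp; positivity
  have h2 : ∫ p, d p ∂(ν.prod ν) = ∫ s in Set.Ioc 0 n, triW a ℙμ n s := by
    rw [integral_prod _ hdi]; rfl
  have h3 : ∫ p, e p ∂(ν.prod ν) = ∫ p, d p ∂(ν.prod ν) := by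
    rw [integral_prod _ hdi, integral_prod _ hei]
    refine integral_congr_ae (.of_forall fun s => ?_)
    refine integral_congr_ae ?_
    have hne : ∀ᵐ u ∂ν, u ≠ s := by
      have : ν {s} = 0 := measure_singleton s
      exact compl_mem_ae_iff.2 this
    filter_upwards [hne] with u hu
    simp only [hd, he]
    rcases lt_or_gt_of_ne hu with h | h
    · rw [if_neg (not_le.2 h), if_neg (not_lt.2 h.le)]
    · rw [if_pos h.le, if_pos h]
  have h4 : ∫ p, c p ∂(ν.prod ν) = (∫ p, d p ∂(ν.prod ν)) + ∫ p, e p ∂(ν.prod ν) := by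
    have h5 : ∫ p, e p ∂(ν.prod ν) = ∫ p, e p.swap ∂(ν.prod ν) :=
      (integral_prod_swap e).symm
    have hei' : Integrable (fun p : ℝ × ℝ => e p.swap) (ν.prod ν) := hei.swap
    rw [h5, ← integral_add hdi hei']
    refine integral_congr_ae (.of_forall fun p => ?_)
    obtain ⟨s, u⟩ := p
    simp only [hd, he, Prod.swap, Function.comp]
    rcases lt_or_ge s u with h | h
    · rw [if_pos h, if_neg (not_le.2 h), add_zero]
    · rw [if_neg (not_lt.2 h), if_pos h, zero_add, hsym]
  rw [h1, h4, h3, h2]; ring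

lemma tri_k {P : ℝ → X → Measure X} (hP : IsMarkovSemigroup P) {μ : Measure X}
    {ℙμ : Measure Ω} [IsProbabilityMeasure ℙμ] {Φ : ℝ → Ω → X}
    (hΦ : IsMarkovProcess P Φ ℙμ μ) {g : X → ℝ} (hm : Measurable g)
    {C : ℝ} (hC : ∀ x, |g x| ≤ C) {n s : ℝ} (hs : 0 ≤ s) (hsn : s ≤ n) :
    triW (fun s ω => g (Φ s ω)) ℙμ n s =
      ∫ r in Set.Ioc 0 (n - s), ∫ ω, g (Φ s ω) * funAct P r g (Φ s ω) ∂ℙμ := by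
  have h1 : triW (fun s ω => g (Φ s ω)) ℙμ n s =
      ∫ u in s..n, ∫ ω, g (Φ s ω) * g (Φ u ω) ∂ℙμ := by
    rw [intervalIntegral.integral_of_le hsn, triW]
    have e : (fun u => if s < u then ∫ ω, g (Φ s ω) * g (Φ u ω) ∂ℙμ else 0) =
        (Set.Ioi s).indicator fun u => ∫ ω, g (Φ s ω) * g (Φ u ω) ∂ℙμ := by
      funext u; simp [Set.indicator]
    rw [e, setIntegral_indicator measurableSet_Ioi]
    congr 2
    ext u
    simp only [Set.mem_inter_iff, Set.mem_Ioc, Set.mem_Ioi]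
    constructor
    · rintro ⟨⟨_, h⟩, h'⟩; exact ⟨h', h⟩
    · rintro ⟨h, h'⟩; exact ⟨⟨hs.trans_lt h, h'⟩, h⟩
  have h2 := intervalIntegral.integral_comp_add_left (a := 0) (b := n - s)
    (fun u => ∫ ω, g (Φ s ω) * g (Φ u ω) ∂ℙμ) s
  rw [add_zero, add_sub_cancel] at h2
  rw [h1, ← h2, intervalIntegral.integral_of_le (by linarith)]
  refine setIntegral_congr_fun measurableSet_Ioc fun r hr => ?_
  exact markov_two hP hΦ hm hm hC hC hs hr.1.le

lemma k_fubini {P : ℝ → X → Measure X} (hP : IsMarkovSemigroup P) {γ : ℝ} (hγ : 0 < γ)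
    {ℙμ : Measure Ω} [IsProbabilityMeasure ℙμ] {Y : Ω → X} (hY : Measurable Y)
    {g : X → ℝ} (hm : Measurable g)
    {C L A : ℝ} (hC0 : 0 ≤ C) (hL : 0 < L) (hC : ∀ x, |g x| ≤ C) {W : X → ℝ}
    (hd : ∀ t, 0 ≤ t → ∀ x, |funAct P t g x| ≤ L * Real.exp (-γ * t) * W x)
    (hWi : Integrable (fun ω => W (Y ω)) ℙμ) (hWA : ∫ ω, W (Y ω) ∂ℙμ ≤ A) :
    IntegrableOn (fun r => ∫ ω, g (Y ω) * funAct P r g (Y ω) ∂ℙμ) (Set.Ioi 0) ∧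
    (∫ r in Set.Ioi (0:ℝ), ∫ ω, g (Y ω) * funAct P r g (Y ω) ∂ℙμ) =
      ∫ ω, g (Y ω) * corrector P g (Y ω) ∂ℙμ ∧
    ∀ r, 0 ≤ r → |∫ ω, g (Y ω) * funAct P r g (Y ω) ∂ℙμ| ≤ C * L * A * Real.exp (-γ * r) := by
  have hb : ∀ r, 0 ≤ r → ∀ ω, |g (Y ω) * funAct P r g (Y ω)| ≤
      C * (L * Real.exp (-γ * r) * W (Y ω)) := fun r hr ω => by
    rw [abs_mul]
    exact mul_le_mul (hC _) (hd r hr _) (abs_nonneg _) hC0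
  have hint : Integrable (fun p : ℝ × Ω => g (Y p.2) * funAct P p.1 g (Y p.2))
      (((volume : Measure ℝ).restrict (Set.Ioi 0)).prod ℙμ) := by
    have hdom : Integrable (fun p : ℝ × Ω => (C * (L * Real.exp (-γ * p.1))) * W (Y p.2))
        (((volume : Measure ℝ).restrict (Set.Ioi 0)).prod ℙμ) :=
      Integrable.mul_prod (f := fun r : ℝ => C * (L * Real.exp (-γ * r)))
        (((integrableOn_exp_mul_Ioi (by linarith) 0).const_mul L).const_mul C) hWi
    have hpos : ∀ᵐ p : ℝ × Ω ∂(((volume : Measure ℝ).restrict (Set.Ioi 0)).prod ℙμ), 0 < p.1 := by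
      have h0 : ∀ᵐ r ∂((volume : Measure ℝ).restrict (Set.Ioi 0)), 0 < r :=
        ae_restrict_mem measurableSet_Ioi
      exact Measure.quasiMeasurePreserving_fst.ae h0
    refine hdom.mono' ?_ ?_
    · have h2 : Measurable fun p : ℝ × Ω => g (Y p.2) * funAct P (max p.1 0) g (Y p.2) :=
        (hm.comp (hY.comp measurable_snd)).mul ((measurable_funAct_joint hP hm).comp
          (measurable_fst.prodMk (hY.comp measurable_snd)))
      refine h2.aestronglyMeasurable.congr ?_
      filter_upwards [hpos] with p hp
      rw [max_eq_left hp.le]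
    · filter_upwards [hpos] with p hp
      refine (hb p.1 hp.le p.2).trans_eq (by ring)
  refine ⟨hint.integral_prod_left, ?_, ?_⟩
  · rw [integral_integral_swap hint]
    refine integral_congr_ae (.of_forall fun ω => ?_)
    simp only [corrector]
    rw [integral_const_mul]
  · intro r hr
    have h := norm_integral_le_of_norm_le (μ := ℙμ)
      (f := fun ω => g (Y ω) * funAct P r g (Y ω))
      ((hWi.const_mul (L * Real.exp (-γ * r))).const_mul C) (.of_forall (hb r hr))
    rw [integral_const_mul, integral_const_mul] at h
    refine h.trans ?_
    calc C * (L * Real.exp (-γ * r) * ∫ ω, W (Y ω) ∂ℙμ) ≤ C * (L * Real.exp (-γ * r) * A) := by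
          gcongr
      _ = _ := by ring

lemma tri_est {P : ℝ → X → Measure X} (hP : IsMarkovSemigroup P) {γ : ℝ} (hγ : 0 < γ)
    {μ : Measure X} {ℙμ : Measure Ω} [IsProbabilityMeasure ℙμ] {Φ : ℝ → Ω → X}
    (hΦ : IsMarkovProcess P Φ ℙμ μ) {g : X → ℝ} (hm : Measurable g)
    {C L A : ℝ} (hC0 : 0 ≤ C) (hL : 0 < L) (hA : 0 ≤ A) (hC : ∀ x, |g x| ≤ C) {W : X → ℝ}
    (hd : ∀ t, 0 ≤ t → ∀ x, |funAct P t g x| ≤ L * Real.exp (-γ * t) * W x)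
    (hW : ∀ t, 0 ≤ t → Integrable (fun ω => W (Φ t ω)) ℙμ ∧ ∫ ω, W (Φ t ω) ∂ℙμ ≤ A)
    {n s : ℝ} (hs : 0 ≤ s) (hsn : s ≤ n) :
    |triW (fun s ω => g (Φ s ω)) ℙμ n s - ∫ ω, g (Φ s ω) * corrector P g (Φ s ω) ∂ℙμ| ≤
      C * L * A / γ * Real.exp (-γ * (n - s)) ∧
    |triW (fun s ω => g (Φ s ω)) ℙμ n s| ≤ C * L * A / γ := by
  obtain ⟨k1, k2, k3⟩ := k_fubini hP hγ (meas_Phi hΦ.jointMeas s) hm hC0 hL hC hd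
    (hW s hs).1 (hW s hs).2
  rw [tri_k hP hΦ hm hC hs hsn, ← k2]
  have hns : 0 ≤ n - s := by linarith
  have hexp : ∀ c : ℝ, IntegrableOn (fun r => C * L * A * Real.exp (-γ * r)) (Set.Ioi c) :=
    fun c => (integrableOn_exp_mul_Ioi (by linarith) c).const_mul _
  have hsplit : (∫ r in Set.Ioi (0:ℝ), ∫ ω, g (Φ s ω) * funAct P r g (Φ s ω) ∂ℙμ) =
      (∫ r in Set.Ioc 0 (n - s), ∫ ω, g (Φ s ω) * funAct P r g (Φ s ω) ∂ℙμ) +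
      ∫ r in Set.Ioi (n - s), ∫ ω, g (Φ s ω) * funAct P r g (Φ s ω) ∂ℙμ := by
    rw [← setIntegral_union (Set.Ioc_disjoint_Ioi le_rfl) measurableSet_Ioi
      (k1.mono_set Set.Ioc_subset_Ioi_self) (k1.mono_set (Set.Ioi_subset_Ioi hns)),
      Set.Ioc_union_Ioi_eq_Ioi hns]
  constructor
  · rw [hsplit, sub_add_cancel_left, abs_neg]
    have h : |∫ r in Set.Ioi (n - s), ∫ ω, g (Φ s ω) * funAct P r g (Φ s ω) ∂ℙμ| ≤
        ∫ r in Set.Ioi (n - s), C * L * A * Real.exp (-γ * r) := by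
      rw [← Real.norm_eq_abs]
      refine norm_integral_le_of_norm_le (hexp _) ?_
      filter_upwards [ae_restrict_mem measurableSet_Ioi] with r hr
      exact k3 r (hns.trans (le_of_lt hr))
    refine h.trans_eq ?_
    rw [integral_const_mul, exp_int hγ]
    ring
  · have h : |∫ r in Set.Ioc 0 (n - s), ∫ ω, g (Φ s ω) * funAct P r g (Φ s ω) ∂ℙμ| ≤
        ∫ r in Set.Ioc 0 (n - s), C * L * A * Real.exp (-γ * r) := by
      rw [← Real.norm_eq_abs]
      refine norm_integral_le_of_norm_le ((hexp 0).mono_set Set.Ioc_subset_Ioi_self) ?_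
      filter_upwards [ae_restrict_mem measurableSet_Ioc] with r hr
      exact k3 r hr.1.le
    refine h.trans ((setIntegral_mono_set (hexp 0) (.of_forall fun r => by positivity)
      Set.Ioc_subset_Ioi_self.eventuallyLE).trans_eq ?_)
    rw [integral_const_mul, exp_int hγ, mul_zero, Real.exp_zero]
    ring

lemma limit_tri {ℙμ : Measure Ω} [IsProbabilityMeasure ℙμ] {a : ℝ → Ω → ℝ}
    (ha : Measurable fun p : ℝ × Ω => a p.1 p.2) {C : ℝ} (hC0 : 0 ≤ C)
    (hC : ∀ s ω, |a s ω| ≤ C) {γ D σ : ℝ} (hγ : 0 < γ) {h : ℝ → ℝ}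
    (hh : Tendsto h atTop (𝓝 σ))
    (hest : ∀ n s, 0 ≤ s → s ≤ n → |triW a ℙμ n s - h s| ≤ D * Real.exp (-γ * (n - s)) ∧
      |triW a ℙμ n s| ≤ D) :
    Tendsto (fun n : ℕ => (∫ ω, (∫ s in (0:ℝ)..n, a s ω) ^ 2 ∂ℙμ) / (n : ℝ)) atTop
      (𝓝 (2 * σ)) := by
  have key : Tendsto (fun n : ℕ => ∫ v in (0:ℝ)..1, triW a ℙμ n (n * v)) atTop
      (𝓝 (∫ _ in (0:ℝ)..1, σ)) := by
    simp only [intervalIntegral.integral_of_le zero_le_one]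
    refine tendsto_integral_of_dominated_convergence (fun _ => D) ?_ (integrable_const _) ?_ ?_
    · intro n
      exact ((triW_meas ha n).comp (measurable_const_mul _)).aestronglyMeasurable
    · intro n
      filter_upwards [ae_restrict_mem measurableSet_Ioc] with v hv
      have hn : (0:ℝ) ≤ n := by positivity
      exact (hest n (n * v) (mul_nonneg hn hv.1.le) (mul_le_of_le_one_right hn hv.2)).2
    · have hne : ∀ᵐ v ∂((volume : Measure ℝ).restrict (Set.Ioc 0 1)), v ≠ 1 :=
        compl_mem_ae_iff.2 (measure_singleton _)
      filter_upwards [ae_restrict_mem measurableSet_Ioc, hne] with v hv hv1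
      have hlt : v < 1 := lt_of_le_of_ne hv.2 hv1
      have hcast : Tendsto (fun n : ℕ => (n : ℝ)) atTop atTop := tendsto_natCast_atTop_atTop
      have t1 : Tendsto (fun n : ℕ => h (n * v)) atTop (𝓝 σ) :=
        hh.comp (hcast.atTop_mul_const hv.1)
      have t2 : Tendsto (fun n : ℕ => D * Real.exp (-γ * (n - n * v))) atTop (𝓝 0) := by
        have := ((exp_tendsto hγ).comp (hcast.atTop_mul_const (sub_pos.2 hlt))).const_mul D
        rw [mul_zero] at this
        refine this.congr fun n => ?_
        simp only [Function.comp_apply]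
        ring_nf
      have t3 : Tendsto (fun n : ℕ => triW a ℙμ n (n * v) - h (n * v)) atTop (𝓝 0) := by
        refine squeeze_zero_norm (fun n => ?_) t2
        have hn : (0:ℝ) ≤ n := by positivity
        exact (hest n (n * v) (mul_nonneg hn hv.1.le) (mul_le_of_le_one_right hn hv.2)).1
      simpa using t3.add t1
  simp only [intervalIntegral.integral_const, sub_zero, one_smul] at key
  refine (key.const_mul 2).congr' ?_
  filter_upwards [eventually_gt_atTop 0] with n hn
  have hn' : (0:ℝ) < n := by exact_mod_cast hn
  have e := intervalIntegral.integral_comp_mul_left (a := 0) (b := 1) (triW a ℙμ n) hn'.ne'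
  simp only [intervalIntegral.integral_of_le hn'.le]
  rw [second_moment_tri ha hC0 hC, e, mul_zero, mul_one,
    intervalIntegral.integral_of_le hn'.le, smul_eq_mul]
  field_simp

lemma combine_limit {ℙμ : Measure Ω} [IsProbabilityMeasure ℙμ] {R I : ℕ → Ω → ℝ} {D σ : ℝ}
    (hR : ∀ n, Measurable (R n)) (hI : ∀ n, Measurable (I n))
    (hRi : ∀ n, Integrable (fun ω => R n ω ^ 2) ℙμ) (hRD : ∀ n, ∫ ω, R n ω ^ 2 ∂ℙμ ≤ D)
    (hIi : ∀ n, Integrable (fun ω => I n ω ^ 2) ℙμ)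
    (hlim : Tendsto (fun n : ℕ => (∫ ω, I n ω ^ 2 ∂ℙμ) / (n : ℝ)) atTop (𝓝 σ)) :
    Tendsto (fun n : ℕ => (∫ ω, (R n ω + I n ω) ^ 2 ∂ℙμ) / (n : ℝ)) atTop (𝓝 σ) := by
  have hs : Tendsto (fun n : ℕ => (Real.sqrt n)⁻¹) atTop (𝓝 0) :=
    (Real.tendsto_sqrt_atTop.comp tendsto_natCast_atTop_atTop).inv_tendsto_atTop
  have hn : Tendsto (fun n : ℕ => ((n : ℝ))⁻¹) atTop (𝓝 0) := tendsto_inv_atTop_nhds_zero_nat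
  have hb : Tendsto (fun n : ℕ => D * ((n : ℝ))⁻¹ + (D * (Real.sqrt n)⁻¹ +
      ((∫ ω, I n ω ^ 2 ∂ℙμ) / (n : ℝ)) * (Real.sqrt n)⁻¹)) atTop (𝓝 0) := by
    simpa using (hn.const_mul D).add ((hs.const_mul D).add (hlim.mul hs))
  have hdiff : Tendsto (fun n : ℕ => (∫ ω, (R n ω + I n ω) ^ 2 ∂ℙμ) / (n : ℝ) -
      (∫ ω, I n ω ^ 2 ∂ℙμ) / (n : ℝ)) atTop (𝓝 0) := by
    refine squeeze_zero_norm' ?_ hb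
    filter_upwards [eventually_gt_atTop 0] with n hn0
    have hnp : (0:ℝ) < n := by exact_mod_cast hn0
    set q := Real.sqrt n with hq
    have hqp : 0 < q := Real.sqrt_pos.2 hnp
    have hqq : q * q = n := Real.mul_self_sqrt hnp.le
    have hpt : ∀ ω, |(R n ω + I n ω) ^ 2 - I n ω ^ 2| ≤
        (1 + q) * R n ω ^ 2 + q⁻¹ * I n ω ^ 2 := by
      intro ω
      have h1 : 2 * |R n ω * I n ω| ≤ q * R n ω ^ 2 + q⁻¹ * I n ω ^ 2 := by
        rw [abs_mul]
        have h2 : 0 ≤ q⁻¹ * (q * |R n ω| - |I n ω|) ^ 2 := by positivity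
        have h3 : q⁻¹ * (q * |R n ω| - |I n ω|) ^ 2 =
            q * |R n ω| ^ 2 - 2 * (|R n ω| * |I n ω|) + q⁻¹ * |I n ω| ^ 2 := by
          field_simp
          ring
        rw [h3, sq_abs, sq_abs] at h2
        linarith
      have e : (R n ω + I n ω) ^ 2 - I n ω ^ 2 = R n ω ^ 2 + 2 * (R n ω * I n ω) := by ring
      rw [e]
      refine (abs_add_le _ _).trans ?_
      rw [abs_of_nonneg (sq_nonneg (R n ω)), abs_mul, abs_two]
      linarith
    have hdom : Integrable (fun ω => (1 + q) * R n ω ^ 2 + q⁻¹ * I n ω ^ 2) ℙμ :=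
      ((hRi n).const_mul _).add ((hIi n).const_mul _)
    have hid : Integrable (fun ω => (R n ω + I n ω) ^ 2 - I n ω ^ 2) ℙμ :=
      hdom.mono' ((((hR n).add (hI n)).pow_const 2).sub
        ((hI n).pow_const 2)).aestronglyMeasurable (.of_forall hpt)
    have hsum : Integrable (fun ω => (R n ω + I n ω) ^ 2) ℙμ := by
      have := hid.add (hIi n)
      refine this.congr (.of_forall fun ω => ?_)
      simp
    rw [← sub_div, ← integral_sub hsum (hIi n), Real.norm_eq_abs, abs_div, abs_of_pos hnp,
      div_le_iff₀ hnp]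
    have hle : |∫ ω, ((R n ω + I n ω) ^ 2 - I n ω ^ 2) ∂ℙμ| ≤
        ∫ ω, ((1 + q) * R n ω ^ 2 + q⁻¹ * I n ω ^ 2) ∂ℙμ := by
      rw [← Real.norm_eq_abs]
      exact norm_integral_le_of_norm_le hdom (.of_forall hpt)
    refine hle.trans ?_
    rw [integral_add ((hRi n).const_mul _) ((hIi n).const_mul _), integral_const_mul,
      integral_const_mul]
    have h5 : (1 + q) * ∫ ω, R n ω ^ 2 ∂ℙμ ≤ (1 + q) * D := by
      gcongr; exact hRD n
    refine (add_le_add_left h5 _).trans_eq ?_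
    rw [← hqq]
    field_simp
    ring
  simpa using hdiff.add hlim

/-- Lemma 7. Under (A1)–(A4), `E_μ[M_n(g)²]/n → σ_g² = 2∫ g χ_g dμ_*`. -/
theorem normalized_variance_limit
    (P : ℝ → X → Measure X) (hP : IsMarkovSemigroup P)
    (γ ζ : ℝ) (x₀ : X) (μ μstar : Measure X)
    [IsProbabilityMeasure μ] [IsProbabilityMeasure μstar]
    (hA1 : CondA1 P) (hA2 : CondA2 P) (hA3 : CondA3 P γ) (hA4 : CondA4 P μ x₀ ζ)
    (hinv : ∀ t, 0 ≤ t → measAct P t μstar = μstar)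
    (g : X → ℝ) (K : ℝ≥0) (hLip : LipschitzWith K g) (hBd : ∃ C, ∀ x, |g x| ≤ C)
    (hmean : ∫ x, g x ∂μstar = 0)
    (ℙμ : Measure Ω) [IsProbabilityMeasure ℙμ]
    (Φ : ℝ → Ω → X) (hΦ : IsMarkovProcess P Φ ℙμ μ) :
    Tendsto (fun n : ℕ => (∫ ω, (mart P g Φ (n : ℝ) ω) ^ 2 ∂ℙμ) / (n : ℝ))
      atTop (𝓝 (2 * ∫ x, g x * corrector P g x ∂μstar)) := by
  obtain ⟨C, hC⟩ := hBd
  have hC0 : 0 ≤ C := (abs_nonneg _).trans (hC x₀)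
  have hm : Measurable g := hLip.continuous.measurable
  have hγ := hA3.2.1
  obtain ⟨L, hL, hg⟩ : ∃ L : ℝ, 0 < L ∧ ∀ x y, |g x - g y| ≤ L * dist x y := by
    refine ⟨K + 1, by positivity, fun x y => ?_⟩
    have h := hLip.dist_le_mul x y
    rw [Real.dist_eq] at h
    have : 0 ≤ dist x y := dist_nonneg
    linarith
  have hVs := moment_star hP hA3 hinv hA4 hΦ
  obtain ⟨A, hA0, hA⟩ := moment_E hA4 hΦ
  set m : ℝ := ∫ y, dist x₀ y ∂μstar with hmdef
  have hm0 : 0 ≤ m := integral_nonneg fun _ => dist_nonneg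
  have hd : ∀ t, 0 ≤ t → ∀ x, |funAct P t g x| ≤
      L * Real.exp (-γ * t) * (dist x₀ x + m) := fun t ht x =>
    decay hP hA3 hinv hVs hL hm hg hC hmean ht x
  have hmΦ := fun t => meas_Phi hΦ.jointMeas t
  have hW : ∀ t, 0 ≤ t → Integrable (fun ω => dist x₀ (Φ t ω) + m) ℙμ ∧
      ∫ ω, (dist x₀ (Φ t ω) + m) ∂ℙμ ≤ (A + 1) + m := by
    intro t ht
    have h1 : Integrable (fun ω => dist x₀ (Φ t ω)) ℙμ :=
      integrable_of_sq (measurable_const.dist (hmΦ t)) (hA t ht).1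
    refine ⟨h1.add (integrable_const _), ?_⟩
    rw [integral_add h1 (integrable_const _)]
    have h2 : ∫ ω, dist x₀ (Φ t ω) ∂ℙμ ≤ ∫ ω, (dist x₀ (Φ t ω) ^ 2 + 1) ∂ℙμ := by
      refine integral_mono h1 ((hA t ht).1.add (integrable_const _)) fun ω => ?_
      change dist x₀ (Φ t ω) ≤ dist x₀ (Φ t ω) ^ 2 + 1
      nlinarith [sq_nonneg (dist x₀ (Φ t ω) - 1), sq_nonneg (dist x₀ (Φ t ω))]
    rw [integral_add (hA t ht).1 (integrable_const _)] at h2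
    simp only [integral_const, probReal_univ, one_smul] at h2 ⊢
    linarith [(hA t ht).2]
  have hχm := corrector_measurable hP hm
  have hχl := corrector_lip hP hA3 hm hL hg hd
  have hχb : ∀ x, corrector P g x ^ 2 ≤ (L / γ) ^ 2 * 2 * (dist x₀ x ^ 2 + m ^ 2) := by
    intro x
    have h := pow_le_pow_left₀ (abs_nonneg _) (corrector_bound hγ hd x) 2
    rw [sq_abs, mul_pow] at h
    refine h.trans ?_
    rw [mul_assoc]
    gcongr
    nlinarith [sq_nonneg (dist x₀ x - m)]
  obtain ⟨B, hBs, hBE⟩ : ∃ B : ℝ, (Integrable (fun x => corrector P g x ^ 2) μstar ∧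
      ∫ x, corrector P g x ^ 2 ∂μstar ≤ B) ∧ ∀ t, 0 ≤ t →
      (Integrable (fun ω => corrector P g (Φ t ω) ^ 2) ℙμ ∧
      ∫ ω, corrector P g (Φ t ω) ^ 2 ∂ℙμ ≤ B) := by
    refine ⟨(L / γ) ^ 2 * 2 * (max A (∫ x, dist x₀ x ^ 2 ∂μstar) + m ^ 2), ⟨?_, ?_⟩,
      fun t ht => ⟨?_, ?_⟩⟩
    · refine ((hVs.add (integrable_const (m ^ 2))).const_mul ((L / γ) ^ 2 * 2)).mono'
        (hχm.pow_const 2).aestronglyMeasurable (.of_forall fun x => ?_)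
      rw [Real.norm_of_nonneg (sq_nonneg _)]
      exact hχb x
    · refine (integral_mono_of_nonneg (.of_forall fun x => sq_nonneg _)
        ((hVs.add (integrable_const (m ^ 2))).const_mul ((L / γ) ^ 2 * 2))
        (.of_forall hχb)).trans ?_
      rw [integral_const_mul]
      simp only [Pi.add_apply]
      rw [integral_add hVs (integrable_const _)]
      simp only [integral_const, probReal_univ, one_smul]
      gcongr
      exact le_max_right _ _
    · refine (((hA t ht).1.add (integrable_const (m ^ 2))).const_mul ((L / γ) ^ 2 * 2)).mono'
        ((hχm.comp (hmΦ t)).pow_const 2).aestronglyMeasurable (.of_forall fun x => ?_)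
      rw [Real.norm_of_nonneg (sq_nonneg _)]
      exact hχb _
    · refine (integral_mono_of_nonneg (.of_forall fun x => sq_nonneg _)
        (((hA t ht).1.add (integrable_const (m ^ 2))).const_mul ((L / γ) ^ 2 * 2))
        (.of_forall fun ω => hχb _)).trans ?_
      rw [integral_const_mul]
      simp only [Pi.add_apply]
      rw [integral_add (hA t ht).1 (integrable_const _)]
      simp only [integral_const, probReal_univ, one_smul]
      gcongr
      exact (hA t ht).2.trans (le_max_left _ _)
  have hconv := conv_chi hP hA3 hinv hΦ hL (by positivity) hC0 hm hg hC hχm hχl hBs.1 hBs.2 hBE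
  have ha : Measurable fun p : ℝ × Ω => g (Φ p.1 p.2) := hm.comp hΦ.jointMeas
  have hI := limit_tri (a := fun s ω => g (Φ s ω)) (ℙμ := ℙμ) ha hC0 (fun s ω => hC _) hγ hconv
    (D := C * L * ((A + 1) + m) / γ) (fun n s hs hsn =>
      tri_est hP hγ hΦ hm hC0 hL (by positivity) hC hd hW hs hsn)
  have hIb : ∀ (n : ℕ) ω, |addFun g Φ n ω| ≤ C * n := by
    intro n ω
    have h := intervalIntegral.norm_integral_le_of_norm_le_const (a := 0) (b := n)
      (f := fun s => g (Φ s ω)) (C := C) (fun s _ => hC _)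
    simpa [addFun] using h
  have hIm : ∀ n : ℕ, Measurable (addFun g Φ (n : ℝ)) := by
    intro n
    have e : addFun g Φ (n : ℝ) = fun ω => ∫ s in Set.Ioc (0 : ℝ) n, g (Φ s ω) := by
      funext ω
      rw [addFun, intervalIntegral.integral_of_le (by positivity)]
    rw [e]
    exact (ha.stronglyMeasurable.integral_prod_left' (μ := (volume : Measure ℝ).restrict
      (Set.Ioc 0 (n : ℝ)))).measurable
  refine combine_limit (R := fun n ω => corrector P g (Φ n ω) - corrector P g (Φ 0 ω))
    (I := fun n ω => addFun g Φ n ω) (D := 4 * B)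
    (fun n => (hχm.comp (hmΦ n)).sub (hχm.comp (hmΦ 0))) hIm ?_ ?_ ?_ hI
  · intro n
    refine (((hBE n (by positivity)).1.add (hBE 0 le_rfl).1).const_mul 2).mono'
      (((hχm.comp (hmΦ n)).sub (hχm.comp (hmΦ 0))).pow_const 2).aestronglyMeasurable
      (.of_forall fun ω => ?_)
    rw [Real.norm_of_nonneg (sq_nonneg _)]
    simp only [Pi.add_apply]
    nlinarith [sq_nonneg (corrector P g (Φ n ω) + corrector P g (Φ 0 ω))]
  · intro n
    have h1 := hBE n (by positivity)
    have h0 := hBE 0 le_rfl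
    refine (integral_mono_of_nonneg (.of_forall fun x => sq_nonneg _)
      ((h1.1.add h0.1).const_mul 2) (.of_forall fun ω => ?_)).trans ?_
    · simp only [Pi.add_apply]
      nlinarith [sq_nonneg (corrector P g (Φ n ω) + corrector P g (Φ 0 ω))]
    · rw [integral_const_mul]
      simp only [Pi.add_apply]
      rw [integral_add h1.1 h0.1]
      linarith [h1.2, h0.2]
  · intro n
    refine integrable_of_bdd (C := (C * n) ^ 2) ((hIm n).pow_const 2) fun ω => ?_
    rw [abs_of_nonneg (sq_nonneg _), ← sq_abs]
    exact pow_le_pow_left₀ (abs_nonneg _) (hIb n ω) 2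

end
end

section
/- Assume conditions (A1)–(A4) and σ_g² > 0. Put s_n² := E_μ[M_n(g)²] and let n̄ be such that s_n² > 0 for all n ≥ n̄. Then for every δ > 0, Σ_{n≥n̄} s_n^{−4} E_μ[Z_n(g)⁴ · 1{|Z_n(g)| < δ s_n}] < ∞, and for every ε > 0, Σ_{n≥n̄} s_n^{−1} E_μ[|Z_n(g)| · 1{|Z_n(g)| ≥ ε s_n}] < ∞. -/
open MeasureTheory Filter Set
open scoped ENNReal Topology NNReal

noncomputable section

variable {X : Type*} [MetricSpace X] [CompleteSpace X] [SecondCountableTopology X]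
  [MeasurableSpace X] [BorelSpace X]

variable {Ω : Type*} [MeasurableSpace Ω]

set_option linter.unusedSectionVars false

namespace HS

lemma meas_P {P : ℝ → X → Measure X} (hP : IsMarkovSemigroup P) :
    Measurable fun p : ℝ × X => P p.1 p.2 :=
  Measure.measurable_of_measurable_coe _ hP.jointMeas

lemma meas_Pt {P : ℝ → X → Measure X} (hP : IsMarkovSemigroup P) (t : ℝ) :
    Measurable (P t) :=
  (meas_P hP).comp measurable_prodMk_left

/-- the kernel `(t,x) ↦ P_{max t 0}(x,·)` -/
def ker {P : ℝ → X → Measure X} (hP : IsMarkovSemigroup P) : ProbabilityTheory.Kernel (ℝ × X) X where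
  toFun p := P (max p.1 0) p.2
  measurable' := (meas_P hP).comp
    (((measurable_fst (α := ℝ) (β := X)).max measurable_const).prodMk measurable_snd)

/-- the kernel `x ↦ P_t(x,·)` -/
def kert {P : ℝ → X → Measure X} (hP : IsMarkovSemigroup P) (t : ℝ) :
    ProbabilityTheory.Kernel X X where
  toFun := P t
  measurable' := meas_Pt hP t

lemma meas_funAct {P : ℝ → X → Measure X} (hP : IsMarkovSemigroup P) {f : X → ℝ}
    (hf : Measurable f) : Measurable fun p : ℝ × X => funAct P (max p.1 0) f p.2 := by
  have := hf.stronglyMeasurable.integral_kernel (κ := ker hP)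
  exact this.measurable

lemma meas_funAct_t {P : ℝ → X → Measure X} (hP : IsMarkovSemigroup P) {f : X → ℝ}
    (hf : Measurable f) (t : ℝ) : Measurable (funAct P t f) :=
  (hf.stronglyMeasurable.integral_kernel (κ := kert hP t)).measurable

lemma funAct_bdd {P : ℝ → X → Measure X} (hP : IsMarkovSemigroup P) {f : X → ℝ} {C : ℝ}
    (hC : ∀ x, |f x| ≤ C) {t : ℝ} (ht : 0 ≤ t) (x : X) : |funAct P t f x| ≤ C := by
  have := hP.prob t ht x
  have := norm_integral_le_of_norm_le_const (μ := P t x) (f := f) (C := C) (ae_of_all _ hC)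
  simpa [funAct] using this

lemma integral_measAct {P : ℝ → X → Measure X} (hP : IsMarkovSemigroup P) {f : X → ℝ}
    (hf : Measurable f) {C : ℝ} (hC : ∀ x, |f x| ≤ C) {t : ℝ} (ht : 0 ≤ t)
    (ν : Measure X) [IsProbabilityMeasure ν] :
    ∫ x, f x ∂(measAct P t ν) = ∫ x, funAct P t f x ∂ν := by
  have : ProbabilityTheory.IsMarkovKernel (kert hP t) := ⟨fun x => hP.prob t ht x⟩
  have : Integrable f (ν.bind (kert hP t)) :=
    Integrable.of_bound hf.aestronglyMeasurable C (ae_of_all _ hC)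
  have h2 := ProbabilityTheory.Kernel.integral_comp (η := kert hP t)
    (κ := ProbabilityTheory.Kernel.const Unit ν) (a := ()) (f := f)
    (by simpa [ProbabilityTheory.Kernel.comp_apply] using this)
  simp only [ProbabilityTheory.Kernel.comp_apply, ProbabilityTheory.Kernel.const_apply] at h2
  exact h2

lemma firstMoment {P : ℝ → X → Measure X} (hP : IsMarkovSemigroup P) {γ : ℝ}
    (hA3 : CondA3 P γ) {t : ℝ} (ht : 0 ≤ t) (x₀ x : X) :
    Integrable (fun y => dist x₀ y) (P t x) := by
  have h0 : FiniteFirstMoment (Measure.dirac x) := by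
    intro z
    exact integrable_dirac (by simp)
  rcases ht.eq_or_lt with rfl | h
  · rw [hP.init]; exact h0 x₀
  · have := hA3.1 _ inferInstance h0 t h x₀
    rwa [measAct, Measure.dirac_bind (meas_Pt hP t)] at this

lemma lip_integrable {f : X → ℝ} {L : ℝ} (hf : ∀ x y, |f x - f y| ≤ L * dist x y)
    (hm : Measurable f) (ν : Measure X) [IsProbabilityMeasure ν] (x₀ : X)
    (hν : Integrable (fun y => dist x₀ y) ν) : Integrable f ν := by
  refine Integrable.mono' (g := fun y => |f x₀| + L * dist x₀ y) ((integrable_const _).add (hν.const_mul L)) hm.aestronglyMeasurable (ae_of_all _ fun y => ?_)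
  have := hf y x₀
  rw [dist_comm] at this
  have h2 := abs_sub_abs_le_abs_sub (f y) (f x₀)
  simp only [Real.norm_eq_abs]
  linarith

lemma contr {P : ℝ → X → Measure X} (hP : IsMarkovSemigroup P) {γ : ℝ}
    (hA3 : CondA3 P γ) {f : X → ℝ} {L : ℝ} (hL : 0 < L)
    (hf : ∀ x y, |f x - f y| ≤ L * dist x y) {t : ℝ} (ht : 0 ≤ t) (x y : X) :
    |funAct P t f x - funAct P t f y| ≤ L * Real.exp (-γ * t) * dist x y := by
  have h1 := hA3.2.2 t ht x y
  have := hP.prob t ht x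
  have := hP.prob t ht y
  have hl : LipschitzWith 1 (fun z => L⁻¹ * f z) := by
    refine LipschitzWith.of_dist_le_mul fun a b => ?_
    rw [Real.dist_eq, ← mul_sub, abs_mul, abs_of_pos (inv_pos.2 hL)]
    simp only [NNReal.coe_one, one_mul]
    rw [inv_mul_le_iff₀ hL]
    exact hf a b
  have hbdd : BddAbove {r | ∃ f : X → ℝ, LipschitzWith 1 f ∧
      r = |(∫ z, f z ∂(P t x)) - ∫ z, f z ∂(P t y)|} := by
    refine ⟨(∫ z, dist x z ∂(P t x)) + ∫ z, dist x z ∂(P t y), ?_⟩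
    rintro r ⟨k, hk, rfl⟩
    have key : ∀ w, |(∫ z, k z ∂(P t w)) - k x| ≤ ∫ z, dist x z ∂(P t w) := by
      intro w
      have := hP.prob t ht w
      have hk' : ∀ a b, |k a - k b| ≤ 1 * dist a b := fun a b => by
        simpa [Real.dist_eq] using hk.dist_le_mul a b
      have hi := lip_integrable hk' hk.continuous.measurable (P t w) x (firstMoment hP hA3 ht x w)
      have : (∫ z, k z ∂(P t w)) - k x = ∫ z, (k z - k x) ∂(P t w) := by
        rw [integral_sub hi (integrable_const _)]; simp
      rw [this]
      refine (abs_integral_le_integral_abs).trans ?_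
      refine integral_mono (hi.sub (integrable_const _)).abs (firstMoment hP hA3 ht x w) fun z => ?_
      have := hk' z x
      rw [dist_comm] at this
      simpa using this
    have := abs_sub_le (∫ z, k z ∂(P t x)) (k x) (∫ z, k z ∂(P t y))
    have h3 := key x
    have h4 := key y
    rw [abs_sub_comm] at h4
    linarith
  have h2 : |(∫ z, L⁻¹ * f z ∂(P t x)) - ∫ z, L⁻¹ * f z ∂(P t y)| ≤ wassDist (P t x) (P t y) :=
    le_csSup hbdd ⟨_, hl, rfl⟩
  rw [integral_const_mul, integral_const_mul, ← mul_sub, abs_mul, abs_of_pos (inv_pos.2 hL),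
    inv_mul_le_iff₀ hL] at h2
  have h3 := h2.trans (mul_le_mul_of_nonneg_left h1 hL.le)
  rw [mul_assoc]
  exact h3

lemma tend_bddLip {P : ℝ → X → Measure X} (hP : IsMarkovSemigroup P) {γ : ℝ}
    (hA3 : CondA3 P γ) {f : X → ℝ} {L : ℝ} (hL : 0 < L)
    (hf : ∀ x y, |f x - f y| ≤ L * dist x y) (hm : Measurable f) {C : ℝ} (hC : ∀ x, |f x| ≤ C)
    (μ μs : Measure X) [IsProbabilityMeasure μ] [IsProbabilityMeasure μs]
    (hinv : ∀ t, 0 ≤ t → measAct P t μs = μs) :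
    Tendsto (fun t => ∫ x, f x ∂(measAct P t μ)) atTop (𝓝 (∫ x, f x ∂μs)) := by
  have h1 : Tendsto (fun t => ∫ p : X × X, (funAct P t f p.1 - funAct P t f p.2) ∂(μ.prod μs))
      atTop (𝓝 (∫ p : X × X, 0 ∂(μ.prod μs))) := by
    refine tendsto_integral_filter_of_dominated_convergence (fun _ => 2 * C) ?_ ?_
      (integrable_const _) ?_
    · refine Eventually.of_forall fun t => Measurable.aestronglyMeasurable ?_
      have := meas_funAct_t hP hm t
      fun_prop
    · filter_upwards [eventually_ge_atTop 0] with t ht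
      refine ae_of_all _ fun p => ?_
      have a := funAct_bdd hP hC ht p.1
      have b := funAct_bdd hP hC ht p.2
      have := abs_sub (funAct P t f p.1) (funAct P t f p.2)
      rw [Real.norm_eq_abs]; linarith
    · refine ae_of_all _ fun p => ?_
      rw [tendsto_zero_iff_abs_tendsto_zero]
      have he : Tendsto (fun t => L * Real.exp (-γ * t) * dist p.1 p.2) atTop (𝓝 0) := by
        have : Tendsto (fun t => Real.exp (-γ * t)) atTop (𝓝 0) := by
          refine Real.tendsto_exp_atBot.comp ?_
          exact tendsto_id.const_mul_atTop_of_neg (by linarith [hA3.2.1])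
        simpa using (this.const_mul L).mul_const (dist p.1 p.2)
      refine tendsto_of_tendsto_of_tendsto_of_le_of_le' tendsto_const_nhds he ?_ ?_
      · exact Eventually.of_forall fun t => abs_nonneg _
      · filter_upwards [eventually_ge_atTop 0] with t ht
        exact contr hP hA3 hL hf ht _ _
  rw [integral_zero] at h1
  have h2 := h1.add_const (∫ x, f x ∂μs)
  rw [zero_add] at h2
  refine h2.congr' ?_
  filter_upwards [eventually_ge_atTop 0] with t ht
  have hi : ∀ ν : Measure X, IsProbabilityMeasure ν → Integrable (funAct P t f) ν := fun ν _ =>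
    Integrable.of_bound (meas_funAct_t hP hm t).aestronglyMeasurable C
      (ae_of_all _ fun x => funAct_bdd hP hC ht x)
  rw [integral_sub ((hi μ inferInstance).comp_fst μs) ((hi μs inferInstance).comp_snd μ)]
  rw [integral_fun_fst, integral_fun_snd, ← integral_measAct hP hm hC ht μ,
    ← integral_measAct hP hm hC ht μs, hinv t ht]
  simp

lemma abs_min_le_one_add {v ζ r : ℝ} (hv : 0 ≤ v) (hr : 0 ≤ r) (h : r ≤ ζ) : v ^ r ≤ 1 + v ^ ζ := by
  have h0 : 0 ≤ v ^ ζ := Real.rpow_nonneg hv _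
  rcases le_total v 1 with h1 | h1
  · have := Real.rpow_le_one hv h1 hr
    linarith
  · have := Real.rpow_le_rpow_of_exponent_le h1 h
    linarith

lemma mom_int {ν : Measure X} [IsProbabilityMeasure ν] {x₀ : X} {ζ M : ℝ} 
    (h : (∫⁻ x, ENNReal.ofReal (dist x₀ x ^ ζ) ∂ν) ≤ ENNReal.ofReal M) :
    Integrable (fun x => dist x₀ x ^ ζ) ν ∧ ∫ x, dist x₀ x ^ ζ ∂ν ≤ max M 0 := by
  have hm : Measurable (fun x => dist x₀ x ^ ζ) := by fun_prop
  have hn : ∀ x, 0 ≤ dist x₀ x ^ ζ := fun x => by positivity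
  refine ⟨⟨hm.aestronglyMeasurable, ?_⟩, ?_⟩
  · rw [hasFiniteIntegral_iff_ofReal (ae_of_all _ hn)]
    exact h.trans_lt ENNReal.ofReal_lt_top
  · rw [integral_eq_lintegral_of_nonneg_ae (ae_of_all _ hn) hm.aestronglyMeasurable]
    have := ENNReal.toReal_mono ENNReal.ofReal_ne_top h
    rwa [ENNReal.toReal_ofReal'] at this

lemma mom_int' {ν : Measure X} [IsProbabilityMeasure ν] {x₀ : X} {ζ M r : ℝ} (hr : 0 < r)
    (hrz : r ≤ ζ)
    (h : (∫⁻ x, ENNReal.ofReal (dist x₀ x ^ ζ) ∂ν) ≤ ENNReal.ofReal M) :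
    Integrable (fun x => dist x₀ x ^ r) ν ∧ ∫ x, dist x₀ x ^ r ∂ν ≤ 1 + max M 0 := by
  obtain ⟨h1, h2⟩ := mom_int h
  have hi : Integrable (fun x => 1 + dist x₀ x ^ ζ) ν := (integrable_const _).add h1
  have hle : ∀ x, dist x₀ x ^ r ≤ 1 + dist x₀ x ^ ζ := fun x =>
    abs_min_le_one_add dist_nonneg hr.le hrz
  have hm : Measurable (fun x => dist x₀ x ^ r) := by fun_prop
  have hir : Integrable (fun x => dist x₀ x ^ r) ν := by
    refine hi.mono' hm.aestronglyMeasurable (ae_of_all _ fun x => ?_)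
    rw [Real.norm_of_nonneg (by positivity)]
    exact hle x
  refine ⟨hir, (integral_mono hir hi hle).trans ?_⟩
  rw [integral_add (integrable_const _) h1]
  simpa using h2

lemma star_moment {P : ℝ → X → Measure X} (hP : IsMarkovSemigroup P) {γ ζ : ℝ}
    (hA3 : CondA3 P γ) (μ μs : Measure X) {x₀ : X} (hA4 : CondA4 P μ x₀ ζ)
    [IsProbabilityMeasure μ] [IsProbabilityMeasure μs]
    (hpr : ∀ t, 0 ≤ t → IsProbabilityMeasure (measAct P t μ))
    (hinv : ∀ t, 0 ≤ t → measAct P t μs = μs) :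
    Integrable (fun x => dist x₀ x) μs := by
  obtain ⟨hζ, M, hM⟩ := hA4
  have hb : ∀ n : ℕ, ∫ x, min (dist x₀ x) n ∂μs ≤ 1 + max M 0 := by
    intro n
    have hl : ∀ x y : X, |min (dist x₀ x) n - min (dist x₀ y) n| ≤ 1 * dist x y := by
      intro x y
      refine (abs_min_sub_min_le_max _ _ _ _).trans ?_
      simp only [sub_self, abs_zero, one_mul]
      refine max_le ?_ dist_nonneg
      rw [dist_comm x₀ x, dist_comm x₀ y]
      exact abs_dist_sub_le x y x₀
    have hm : Measurable (fun x : X => min (dist x₀ x) (n : ℝ)) := by fun_prop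
    have hC : ∀ x : X, |min (dist x₀ x) n| ≤ n := by
      intro x
      rw [abs_of_nonneg (le_min dist_nonneg (Nat.cast_nonneg n))]
      exact min_le_right _ _
    have := tend_bddLip hP hA3 one_pos hl hm hC μ μs hinv
    refine le_of_tendsto this ?_
    filter_upwards [eventually_ge_atTop 0] with t ht
    have := hpr t ht
    obtain ⟨h1, h2⟩ := mom_int' (r := 1) one_pos (by linarith) (hM t ht)
    refine le_trans (integral_mono (Integrable.of_bound hm.aestronglyMeasurable n (ae_of_all _ hC)) h1 ?_) h2
    intro x
    simp
  have hm : Measurable (fun x : X => dist x₀ x) := by fun_prop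
  refine ⟨hm.aestronglyMeasurable, ?_⟩
  rw [hasFiniteIntegral_iff_ofReal (ae_of_all _ fun x => dist_nonneg)]
  have ht := lintegral_tendsto_of_tendsto_of_monotone (μ := μs)
    (f := fun (n : ℕ) (x : X) => ENNReal.ofReal (min (dist x₀ x) n))
    (F := fun x => ENNReal.ofReal (dist x₀ x)) (fun n => by fun_prop)
    (ae_of_all _ fun x => by
      intro n m h
      have : (n : ℝ) ≤ m := by exact_mod_cast h
      dsimp only
      gcongr)
    (ae_of_all _ fun x => by
      refine tendsto_const_nhds.congr' ?_
      obtain ⟨N, hN⟩ := exists_nat_ge (dist x₀ x)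
      filter_upwards [eventually_ge_atTop N] with n hn
      have : (N : ℝ) ≤ n := by exact_mod_cast hn
      rw [min_eq_left (by linarith)])
  refine (le_of_tendsto' ht (b := ENNReal.ofReal (1 + max M 0)) fun n => ?_).trans_lt ENNReal.ofReal_lt_top
  have hC : ∀ x : X, ‖min (dist x₀ x) (n:ℝ)‖ ≤ n := by
    intro x
    rw [Real.norm_of_nonneg (le_min dist_nonneg (Nat.cast_nonneg n))]
    exact min_le_right _ _
  have hm : Measurable (fun x : X => min (dist x₀ x) (n : ℝ)) := by fun_prop
  rw [← ofReal_integral_eq_lintegral_ofReal (Integrable.of_bound hm.aestronglyMeasurable n (ae_of_all _ hC)) (ae_of_all _ fun x => le_min dist_nonneg (Nat.cast_nonneg n))]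
  exact ENNReal.ofReal_le_ofReal (hb n)

lemma decay {P : ℝ → X → Measure X} (hP : IsMarkovSemigroup P) {γ : ℝ}
    (hA3 : CondA3 P γ) {g : X → ℝ} {L : ℝ} (hL : 0 < L)
    (hg : ∀ x y, |g x - g y| ≤ L * dist x y) (hm : Measurable g) {C : ℝ} (hC : ∀ x, |g x| ≤ C)
    (μs : Measure X) [IsProbabilityMeasure μs] {x₀ : X}
    (hinv : ∀ t, 0 ≤ t → measAct P t μs = μs) (hs : Integrable (fun x => dist x₀ x) μs)
    (hmean : ∫ x, g x ∂μs = 0) {t : ℝ} (ht : 0 ≤ t) (x : X) :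
    |funAct P t g x| ≤ L * (dist x₀ x + ∫ y, dist x₀ y ∂μs) * Real.exp (-γ * t) := by
  have h0 : ∫ y, funAct P t g y ∂μs = 0 := by
    rw [← integral_measAct hP hm hC ht μs, hinv t ht, hmean]
  have hi : Integrable (funAct P t g) μs :=
    Integrable.of_bound (meas_funAct_t hP hm t).aestronglyMeasurable C
      (ae_of_all _ fun x => funAct_bdd hP hC ht x)
  have h1 : funAct P t g x = ∫ y, (funAct P t g x - funAct P t g y) ∂μs := by
    rw [integral_sub (integrable_const _) hi, h0]; simp
  have hr : Integrable (fun y => L * Real.exp (-γ * t) * (dist x₀ x + dist x₀ y)) μs :=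
    ((integrable_const _).add hs).const_mul _
  rw [h1]
  refine abs_integral_le_integral_abs.trans ?_
  refine (integral_mono (((integrable_const _).sub hi).abs) hr fun y => ?_).trans ?_
  · refine (contr hP hA3 hL hg ht x y).trans ?_
    have := dist_triangle_left x y x₀
    gcongr
  · rw [integral_const_mul, integral_add (integrable_const _) hs]
    simp only [integral_const, probReal_univ, smul_eq_mul, one_mul]
    apply le_of_eq; ring

lemma int_exp {γ : ℝ} (hγ : 0 < γ) (A c : ℝ) :
    IntegrableOn (fun t => A * Real.exp (-γ * t)) (Ioi c) ∧
      ∫ t in Ioi c, A * Real.exp (-γ * t) = A * Real.exp (-γ * c) / γ := by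
  have h : -γ < 0 := by linarith
  refine ⟨(integrableOn_exp_mul_Ioi h c).const_mul A, ?_⟩
  rw [integral_const_mul, integral_exp_mul_Ioi h]
  field_simp

lemma meas_funAct_s {P : ℝ → X → Measure X} (hP : IsMarkovSemigroup P) {g : X → ℝ}
    (hm : Measurable g) (x : X) :
    AEStronglyMeasurable (fun t => funAct P t g x) (volume.restrict (Ioi 0)) := by
  have h1 : Measurable (fun t => funAct P (max t 0) g x) :=
    (meas_funAct hP hm).comp (measurable_id.prodMk measurable_const)
  refine h1.aestronglyMeasurable.congr ?_
  filter_upwards [ae_restrict_mem measurableSet_Ioi] with t ht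
  rw [max_eq_left (le_of_lt ht)]

lemma corr_props {P : ℝ → X → Measure X} (hP : IsMarkovSemigroup P) {γ : ℝ}
    (hA3 : CondA3 P γ) {g : X → ℝ} {L : ℝ} (hL : 0 < L)
    (hg : ∀ x y, |g x - g y| ≤ L * dist x y) (hm : Measurable g) {C : ℝ} (hC : ∀ x, |g x| ≤ C)
    (μs : Measure X) [IsProbabilityMeasure μs] {x₀ : X}
    (hinv : ∀ t, 0 ≤ t → measAct P t μs = μs) (hs : Integrable (fun x => dist x₀ x) μs)
    (hmean : ∫ x, g x ∂μs = 0) :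
    (∀ x, IntegrableOn (fun t => funAct P t g x) (Ioi 0)) ∧
    (∀ x y, |corrector P g x - corrector P g y| ≤ L / γ * dist x y) ∧
    (∀ x, |corrector P g x| ≤ L / γ * (dist x₀ x + ∫ y, dist x₀ y ∂μs)) := by
  have hγ := hA3.2.1
  have hI : ∀ x, IntegrableOn (fun t => funAct P t g x) (Ioi 0) := by
    intro x
    refine Integrable.mono' (int_exp hγ (L * (dist x₀ x + ∫ y, dist x₀ y ∂μs)) 0).1
      (meas_funAct_s hP hm x) ?_
    filter_upwards [ae_restrict_mem measurableSet_Ioi] with t ht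
    exact decay hP hA3 hL hg hm hC μs hinv hs hmean (le_of_lt ht) x
  refine ⟨hI, fun x y => ?_, fun x => ?_⟩
  · rw [corrector, corrector, ← integral_sub (hI x) (hI y)]
    have h2 := int_exp hγ (L * dist x y) 0
    refine abs_integral_le_integral_abs.trans ?_
    refine (setIntegral_mono_on ((hI x).sub (hI y)).abs h2.1 measurableSet_Ioi fun t ht => ?_).trans ?_
    · refine (contr hP hA3 hL hg (le_of_lt ht) x y).trans (le_of_eq (by ring))
    · rw [h2.2]
      apply le_of_eq; simp; ring
  · rw [corrector]
    have h2 := int_exp hγ (L * (dist x₀ x + ∫ y, dist x₀ y ∂μs)) 0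
    refine abs_integral_le_integral_abs.trans ?_
    refine (setIntegral_mono_on (hI x).abs h2.1 measurableSet_Ioi fun t ht => ?_).trans ?_
    · exact decay hP hA3 hL hg hm hC μs hinv hs hmean (le_of_lt ht) x
    · rw [h2.2]
      apply le_of_eq; simp; ring

lemma trunc_err {q N : ℝ} (hN : 0 < N) : |q - max (-N) (min q N)| ≤ q ^ 2 / N := by
  rw [le_div_iff₀ hN]
  rcases le_total q N with h | h
  · rw [min_eq_left h]
    rcases le_total (-N) q with h' | h'
    · rw [max_eq_right h']; simp; positivity
    · rw [max_eq_left h', abs_of_nonpos (by linarith)]; nlinarith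
  · rw [min_eq_right h, max_eq_right (by linarith), abs_of_nonneg (by linarith)]; nlinarith

lemma trunc_lip (a b N : ℝ) : |max (-N) (min a N) - max (-N) (min b N)| ≤ |a - b| := by
  refine (abs_max_sub_max_le_max _ _ _ _).trans ?_
  simp only [sub_self, abs_zero]
  refine max_le (abs_nonneg _) ((abs_min_sub_min_le_max _ _ _ _).trans ?_)
  simp

lemma trunc_bd {a N : ℝ} (hN : 0 < N) : |max (-N) (min a N)| ≤ N := by
  rw [abs_le]; exact ⟨le_max_left _ _, max_le (by linarith) (min_le_right _ _)⟩

lemma trunc_le {a N : ℝ} (hN : 0 < N) : |max (-N) (min a N)| ≤ |a| := by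
  have := trunc_lip a 0 N
  simpa [hN.le] using this

lemma lower_H {P : ℝ → X → Measure X} (hP : IsMarkovSemigroup P) {γ : ℝ}
    (hA3 : CondA3 P γ) {g q : X → ℝ} {L L' : ℝ} (hL : 0 < L) (hL' : 0 < L')
    (hg : ∀ x y, |g x - g y| ≤ L * dist x y) (hm : Measurable g) {C : ℝ} (hC0 : 0 < C)
    (hC : ∀ x, |g x| ≤ C)
    (hq : ∀ x y, |q x - q y| ≤ L' * dist x y) (hqm : Measurable q)
    (μ μs : Measure X) [IsProbabilityMeasure μ] [IsProbabilityMeasure μs]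
    (hpr : ∀ t, 0 ≤ t → IsProbabilityMeasure (measAct P t μ))
    (hinv : ∀ t, 0 ≤ t → measAct P t μs = μs) {B : ℝ}
    (hB : ∀ t, 0 ≤ t → Integrable (fun x => q x ^ 2) (measAct P t μ) ∧
      ∫ x, q x ^ 2 ∂(measAct P t μ) ≤ B)
    (hqi : ∀ t, 0 ≤ t → Integrable q (measAct P t μ))
    (ha : 0 < ∫ x, g x * q x ∂μs) :
    ∃ c > 0, ∃ T, 0 ≤ T ∧ ∀ t, T ≤ t → c ≤ ∫ x, g x * q x ∂(measAct P t μ) := by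
  set a := ∫ x, g x * q x ∂μs with hadef
  have hint : Integrable (fun x => g x * q x) μs := by
    by_contra h
    rw [hadef, integral_undef h] at ha
    exact lt_irrefl _ ha
  have hd : Tendsto (fun n : ℕ => ∫ x, g x * max (-(n + 1 : ℝ)) (min (q x) (n + 1)) ∂μs) atTop (𝓝 a) := by
    refine tendsto_integral_of_dominated_convergence (fun x => |g x * q x|) (fun n => ?_)
      hint.abs (fun n => ?_) ?_
    · apply Measurable.aestronglyMeasurable; fun_prop
    · refine ae_of_all _ fun x => ?_
      rw [Real.norm_eq_abs, abs_mul, abs_mul]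
      exact mul_le_mul_of_nonneg_left (trunc_le (by positivity)) (abs_nonneg _)
    · refine ae_of_all _ fun x => ?_
      refine tendsto_const_nhds.congr' ?_
      obtain ⟨N, hN⟩ := exists_nat_ge (|q x|)
      filter_upwards [eventually_ge_atTop N] with n hn
      have : (N : ℝ) ≤ n := by exact_mod_cast hn
      have h1 := abs_le.1 hN
      rw [min_eq_left (by linarith), max_eq_right (by linarith)]
  have hd2 : Tendsto (fun n : ℕ => C * B * (1 / ((n : ℝ) + 1))) atTop (𝓝 0) := by
    simpa using tendsto_one_div_add_atTop_nhds_zero_nat.const_mul (C * B)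
  obtain ⟨n, hn1, hn2⟩ := ((hd.eventually (lt_mem_nhds (show a * (3/4) < a by linarith))).and
    (hd2.eventually (gt_mem_nhds (show (0:ℝ) < a / 4 by linarith)))).exists
  have hN : (0 : ℝ) < n + 1 := by positivity
  set N : ℝ := n + 1 with hNdef
  have hl : ∀ x y, |g x * max (-N) (min (q x) N) - g y * max (-N) (min (q y) N)| ≤ (C * L' + N * L) * dist x y := by
    intro x y
    have e : g x * max (-N) (min (q x) N) - g y * max (-N) (min (q y) N) =
      g x * (max (-N) (min (q x) N) - max (-N) (min (q y) N)) + max (-N) (min (q y) N) * (g x - g y) := by ring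
    rw [e]
    refine (abs_add_le _ _).trans ?_
    rw [abs_mul, abs_mul]
    have h1 := mul_le_mul (hC x) ((trunc_lip (q x) (q y) N).trans (hq x y)) (abs_nonneg _) hC0.le
    have h2 := mul_le_mul (trunc_bd (a := q y) hN) (hg x y) (abs_nonneg _) hN.le
    linarith
  have hbd : ∀ x, |g x * max (-N) (min (q x) N)| ≤ C * N := fun x => by
    rw [abs_mul]; exact mul_le_mul (hC x) (trunc_bd hN) (abs_nonneg _) hC0.le
  have hmm : Measurable (fun x => g x * max (-N) (min (q x) N)) := by fun_prop
  have ht := tend_bddLip hP hA3 (by positivity) hl hmm hbd μ μs hinv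
  obtain ⟨T, hT⟩ := eventually_atTop.1 ((ht.eventually (lt_mem_nhds hn1)).and (eventually_ge_atTop 0))
  refine ⟨a / 2, by linarith, max T 0, le_max_right _ _, fun t htt => ?_⟩
  have ht0 : 0 ≤ t := (le_max_right _ _).trans htt
  have := hpr t ht0
  have h1 := (hT t ((le_max_left _ _).trans htt)).1
  have hi1 : Integrable (fun x => g x * q x) (measAct P t μ) :=
    (hqi t ht0).bdd_mul hm.aestronglyMeasurable (ae_of_all _ hC)
  have hi2 : Integrable (fun x => g x * max (-N) (min (q x) N)) (measAct P t μ) :=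
    Integrable.of_bound hmm.aestronglyMeasurable _ (ae_of_all _ hbd)
  have h3 : ∫ x, g x * max (-N) (min (q x) N) ∂(measAct P t μ) - ∫ x, g x * q x ∂(measAct P t μ)
     ≤ ∫ x, C / N * q x ^ 2 ∂(measAct P t μ) := by
    rw [← integral_sub hi2 hi1]
    refine integral_mono (hi2.sub hi1) ((hB t ht0).1.const_mul _) fun x => ?_
    refine (le_abs_self _).trans ?_
    dsimp only
    rw [← mul_sub, abs_mul, abs_sub_comm]
    have := mul_le_mul (hC x) (trunc_err (q := q x) hN) (abs_nonneg _) hC0.le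
    refine this.trans (le_of_eq (by ring))
  rw [integral_const_mul] at h3
  have h4 : C / N * ∫ x, q x ^ 2 ∂(measAct P t μ) ≤ C * B * (1 / N) := by
    have := mul_le_mul_of_nonneg_left (hB t ht0).2 (show 0 ≤ C / N by positivity)
    refine this.trans (le_of_eq (by ring))
  linarith

lemma bdd_int {α : Type*} [MeasurableSpace α] {ν : Measure α} [IsFiniteMeasure ν] {f : α → ℝ}
    (hf : Measurable f) (C : ℝ) (hC : ∀ x, |f x| ≤ C) : Integrable f ν :=
  Integrable.of_bound hf.aestronglyMeasurable C (ae_of_all _ hC)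

lemma abs_ite_le {p : Prop} [Decidable p] {a C : ℝ} (h : |a| ≤ C) : |if p then a else 0| ≤ C := by
  split_ifs
  · exact h
  · simpa using (abs_nonneg a).trans h

lemma tri {f : ℝ → ℝ} (hf : Measurable f) {C : ℝ} (hC : ∀ x, |f x| ≤ C) (n : ℝ) :
    (∫ s in Ioc 0 n, f s) ^ 2 =
      2 * ∫ s in Ioc 0 n, ∫ u in Ioc 0 n, if s + u ≤ n then f s * f (s + u) else 0 := by
  classical
  set ν : Measure ℝ := volume.restrict (Ioc 0 n) with hν
  have hC0 : 0 ≤ C := (abs_nonneg _).trans (hC 0)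
  have hCC : ∀ s t, |f s * f t| ≤ C * C := fun s t => by
    rw [abs_mul]; exact mul_le_mul (hC _) (hC _) (abs_nonneg _) hC0
  have m1 : Measurable (fun p : ℝ × ℝ => if p.1 < p.2 then f p.1 * f p.2 else 0) :=
    Measurable.ite (measurableSet_lt measurable_fst measurable_snd) (by fun_prop) measurable_const
  have m2 : Measurable (fun p : ℝ × ℝ => if p.2 ≤ p.1 then f p.1 * f p.2 else 0) :=
    Measurable.ite (measurableSet_le measurable_snd measurable_fst) (by fun_prop) measurable_const
  have i1 : Integrable (fun p : ℝ × ℝ => if p.1 < p.2 then f p.1 * f p.2 else 0) (ν.prod ν) :=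
    bdd_int m1 (C * C) fun p => abs_ite_le (hCC _ _)
  have i2 : Integrable (fun p : ℝ × ℝ => if p.2 ≤ p.1 then f p.1 * f p.2 else 0) (ν.prod ν) :=
    bdd_int m2 (C * C) fun p => abs_ite_le (hCC _ _)
  have h1 : (∫ s, f s ∂ν) ^ 2 = (∫ s, ∫ t, (if s < t then f s * f t else 0) ∂ν ∂ν) +
      ∫ s, ∫ t, (if t ≤ s then f s * f t else 0) ∂ν ∂ν := by
    rw [sq, ← integral_prod_mul]
    rw [← integral_prod _ i1, ← integral_prod _ i2, ← integral_add i1 i2]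
    refine integral_congr_ae (ae_of_all _ fun p => ?_)
    dsimp only
    rcases lt_or_ge p.1 p.2 with h | h
    · rw [if_pos h, if_neg (not_le.2 h), add_zero]
    · rw [if_neg (not_lt.2 h), if_pos h, zero_add]
  have h2 : ∫ s, ∫ t, (if t ≤ s then f s * f t else 0) ∂ν ∂ν =
      ∫ s, ∫ t, (if s < t then f s * f t else 0) ∂ν ∂ν := by
    rw [integral_integral_swap i2]
    refine integral_congr_ae (ae_of_all _ fun s => ?_)
    refine integral_congr_ae ?_
    have : ∀ᵐ t ∂ν, t ≠ s := by
      rw [hν]; exact ae_restrict_of_ae (Measure.ae_ne volume s)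
    filter_upwards [this] with t ht
    by_cases h : s < t
    · rw [if_pos h, if_pos h.le, mul_comm]
    · rw [if_neg h, if_neg (fun h' => h (lt_of_le_of_ne h' ht.symm))]
  rw [h1, h2, ← two_mul]
  congr 1
  refine setIntegral_congr_fun measurableSet_Ioc fun s hs => ?_
  have e1 : ∀ t, (Ioc 0 n).indicator (fun t => if s < t then f s * f t else 0) t
      = (Ioc s n).indicator (fun t => f s * f t) t := by
    intro t
    by_cases h : t ∈ Ioc s n
    · have : t ∈ Ioc 0 n := ⟨hs.1.trans h.1, h.2⟩
      rw [indicator_of_mem this, indicator_of_mem h, if_pos h.1]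
    · rw [indicator_of_notMem h]
      by_cases h' : t ∈ Ioc 0 n
      · rw [indicator_of_mem h', if_neg (fun h'' => h ⟨h'', h'.2⟩)]
      · rw [indicator_of_notMem h']
  have e2 : ∀ u, (Ioc 0 n).indicator (fun u => if s + u ≤ n then f s * f (s + u) else 0) u
      = (Ioc s n).indicator (fun t => f s * f t) (s + u) := by
    intro u
    by_cases h : s + u ∈ Ioc s n
    · have : u ∈ Ioc 0 n := ⟨by linarith [h.1], by linarith [h.2, hs.1]⟩
      rw [indicator_of_mem this, indicator_of_mem h, if_pos h.2]
    · rw [indicator_of_notMem h]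
      by_cases h' : u ∈ Ioc 0 n
      · rw [indicator_of_mem h', if_neg (fun h'' => h ⟨by linarith [h'.1], h''⟩)]
      · rw [indicator_of_notMem h']
  rw [hν, ← integral_indicator measurableSet_Ioc, ← integral_indicator measurableSet_Ioc]
  simp_rw [e1, e2]
  exact (integral_add_left_eq_self _ s).symm

lemma exp_int_le {γ : ℝ} (hγ : 0 < γ) (n : ℝ) :
    ∫ s in Ioc 0 n, Real.exp (-γ * s) ≤ 1 / γ := by
  have h := int_exp hγ 1 0
  simp only [one_mul, mul_zero, Real.exp_zero] at h
  rw [← h.2]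
  exact setIntegral_mono_set h.1 (ae_of_all _ fun s => (Real.exp_pos _).le)
    (Ioc_subset_Ioi_self.eventuallyLE)

lemma exp_int_le' {γ : ℝ} (hγ : 0 < γ) {n : ℝ} (hn : 0 ≤ n) :
    ∫ s in Ioc 0 n, Real.exp (-γ * (n - s)) ≤ 1 / γ := by
  refine le_trans (le_of_eq ?_) (exp_int_le hγ n)
  rw [← intervalIntegral.integral_of_le hn, ← intervalIntegral.integral_of_le hn]
  have := intervalIntegral.integral_comp_sub_left (a := 0) (b := n) (fun s => Real.exp (-γ * s)) n
  simpa using this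

lemma I_lower {G : ℝ → Ω → ℝ} (hG : Measurable fun p : ℝ × Ω => G p.1 p.2) {C : ℝ}
    (hC : ∀ s ω, |G s ω| ≤ C) (ℙ : Measure Ω) [IsProbabilityMeasure ℙ] {γ D c T : ℝ}
    (hγ : 0 < γ) (hc : 0 < c)
    (hk : ∀ s u, 0 ≤ s → 0 ≤ u → |∫ ω, G s ω * G (s + u) ω ∂ℙ| ≤ D * Real.exp (-γ * u))
    (hH : ∀ s, T ≤ s → c ≤ ∫ u in Ioi 0, ∫ ω, G s ω * G (s + u) ω ∂ℙ) :
    ∃ R, ∀ n : ℝ, 0 ≤ n → 2 * c * n - R ≤ ∫ ω, (∫ s in (0:ℝ)..n, G s ω) ^ 2 ∂ℙ := by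
  classical
  set k : ℝ → ℝ → ℝ := fun s u => ∫ ω, G s ω * G (s + u) ω ∂ℙ with hkdef
  have hne : Nonempty Ω := by
    by_contra h
    rw [not_nonempty_iff] at h
    have := measure_univ (μ := ℙ)
    rw [Set.univ_eq_empty_iff.2 h] at this
    simp at this
  have hC0 : 0 ≤ C := (abs_nonneg _).trans (hC 0 hne.some)
  have hD0 : 0 ≤ D := by
    have := (abs_nonneg _).trans (hk 0 0 le_rfl le_rfl)
    simpa using this
  have hCC : ∀ s t ω, |G s ω * G t ω| ≤ C * C := fun s t ω => by
    rw [abs_mul]; exact mul_le_mul (hC _ _) (hC _ _) (abs_nonneg _) hC0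
  have mk : Measurable (fun p : ℝ × ℝ => k p.1 p.2) := by
    have : Measurable (fun q : (ℝ × ℝ) × Ω => G q.1.1 q.2 * G (q.1.1 + q.1.2) q.2) := by
      refine Measurable.mul (hG.comp (f := fun q : (ℝ × ℝ) × Ω => (q.1.1, q.2)) (by fun_prop))
        (hG.comp (f := fun q : (ℝ × ℝ) × Ω => (q.1.1 + q.1.2, q.2)) (by fun_prop))
    exact (this.stronglyMeasurable.integral_prod_right' (ν := ℙ)).measurable
  have mks : ∀ s, Measurable (k s) := fun s => mk.comp measurable_prodMk_left
  have ki : ∀ s, 0 ≤ s → ∀ b, 0 ≤ b → IntegrableOn (k s) (Ioi b) := by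
    intro s hs b hb
    refine Integrable.mono' (int_exp hγ D b).1 (mks s).aestronglyMeasurable ?_
    filter_upwards [ae_restrict_mem measurableSet_Ioi] with u hu
    exact hk s u hs (hb.trans (le_of_lt hu))
  have kt : ∀ s, 0 ≤ s → ∀ b, 0 ≤ b → |∫ u in Ioi b, k s u| ≤ D / γ * Real.exp (-γ * b) := by
    intro s hs b hb
    refine abs_integral_le_integral_abs.trans ?_
    have h2 := int_exp hγ D b
    refine (setIntegral_mono_on (ki s hs b hb).abs h2.1 measurableSet_Ioi fun u hu => ?_).trans ?_
    · exact hk s u hs (hb.trans (le_of_lt hu))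
    · rw [h2.2]; apply le_of_eq; ring
  -- lower bound of H
  have hHs : ∀ s, 0 ≤ s → c - (c + D / γ) * Real.exp (γ * T) * Real.exp (-γ * s) ≤ ∫ u in Ioi 0, k s u := by
    intro s hs
    rcases le_or_gt T s with h | h
    · have := hH s h
      have h2 : 0 ≤ (c + D / γ) * Real.exp (γ * T) * Real.exp (-γ * s) := by positivity
      linarith
    · have h1 := (abs_le.1 (kt s hs 0 le_rfl)).1
      have h2 : 1 ≤ Real.exp (γ * T) * Real.exp (-γ * s) := by
        rw [← Real.exp_add]
        apply Real.one_le_exp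
        nlinarith
      have h3 : (c + D / γ) * 1 ≤ (c + D / γ) * (Real.exp (γ * T) * Real.exp (-γ * s)) :=
        mul_le_mul_of_nonneg_left h2 (by positivity)
      simp only [mul_zero, Real.exp_zero, mul_one] at h1 h3
      rw [mul_assoc]
      linarith
  set A := (c + D / γ) * Real.exp (γ * T) with hA
  have hA0 : 0 ≤ A := by positivity
  refine ⟨2 * (A * (1 / γ) + D / γ * (1 / γ)), fun n hn => ?_⟩
  -- the identity
  have hid : ∫ ω, (∫ s in (0:ℝ)..n, G s ω) ^ 2 ∂ℙ =
      2 * ∫ s in Ioc 0 n, ∫ u in Ioc 0 n, if s + u ≤ n then k s u else 0 := by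
    set ν : Measure ℝ := volume.restrict (Ioc 0 n) with hν
    have e : ∀ ω, (∫ s in (0:ℝ)..n, G s ω) ^ 2 =
        2 * ∫ p : ℝ × ℝ, (if p.1 + p.2 ≤ n then G p.1 ω * G (p.1 + p.2) ω else 0) ∂(ν.prod ν) := by
      intro ω
      have hGω : Measurable (fun s => G s ω) := hG.comp measurable_prodMk_right
      rw [intervalIntegral.integral_of_le hn, tri hGω (fun s => hC s ω) n, integral_prod]
      refine bdd_int ?_ (C * C) fun p => abs_ite_le (hCC _ _ _)
      refine Measurable.ite (measurableSet_le (by fun_prop) measurable_const) ?_ measurable_const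
      exact (hGω.comp measurable_fst).mul (hGω.comp (measurable_fst.add measurable_snd))
    simp_rw [e]
    rw [integral_const_mul]
    congr 1
    have m3 : Measurable (fun q : Ω × (ℝ × ℝ) =>
        if q.2.1 + q.2.2 ≤ n then G q.2.1 q.1 * G (q.2.1 + q.2.2) q.1 else 0) := by
      refine Measurable.ite (measurableSet_le (by fun_prop) measurable_const) ?_ measurable_const
      exact Measurable.mul (hG.comp (f := fun q : Ω × (ℝ × ℝ) => (q.2.1, q.1)) (by fun_prop))
        (hG.comp (f := fun q : Ω × (ℝ × ℝ) => (q.2.1 + q.2.2, q.1)) (by fun_prop))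
    have i3 : Integrable (fun q : Ω × (ℝ × ℝ) =>
        if q.2.1 + q.2.2 ≤ n then G q.2.1 q.1 * G (q.2.1 + q.2.2) q.1 else 0) (ℙ.prod (ν.prod ν)) :=
      bdd_int m3 (C * C) fun p => abs_ite_le (hCC _ _ _)
    rw [integral_integral_swap (f := fun ω (p : ℝ × ℝ) => if p.1 + p.2 ≤ n then G p.1 ω * G (p.1 + p.2) ω else 0) i3]
    have e4 : ∀ p : ℝ × ℝ, ∫ ω, (if p.1 + p.2 ≤ n then G p.1 ω * G (p.1 + p.2) ω else 0) ∂ℙ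
        = if p.1 + p.2 ≤ n then k p.1 p.2 else 0 := by
      intro p
      split_ifs <;> simp [hkdef]
    simp_rw [e4]
    rw [integral_prod]
    have := i3.integral_prod_right
    simp_rw [e4] at this
    exact this
  rw [hid]
  have hin : ∀ s ∈ Ioc 0 n, c - A * Real.exp (-γ * s) - D / γ * Real.exp (-γ * (n - s)) ≤
      ∫ u in Ioc 0 n, if s + u ≤ n then k s u else 0 := by
    intro s hs
    have hns : 0 ≤ n - s := by linarith [hs.2]
    have e1 : (∫ u in Ioc 0 n, if s + u ≤ n then k s u else 0) = ∫ u in Ioc 0 (n - s), k s u := by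
      rw [← integral_indicator measurableSet_Ioc, ← integral_indicator measurableSet_Ioc]
      congr 1
      ext u
      by_cases h : u ∈ Ioc 0 (n - s)
      · have : u ∈ Ioc 0 n := ⟨h.1, by linarith [h.2, hs.1]⟩
        rw [indicator_of_mem this, indicator_of_mem h, if_pos (by linarith [h.2])]
      · rw [indicator_of_notMem h]
        by_cases h' : u ∈ Ioc 0 n
        · rw [indicator_of_mem h', if_neg (fun h'' => h ⟨h'.1, by linarith⟩)]
        · rw [indicator_of_notMem h']
    have e2 : ∫ u in Ioi 0, k s u = (∫ u in Ioc 0 (n - s), k s u) + ∫ u in Ioi (n - s), k s u := by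
      rw [← setIntegral_union Ioc_disjoint_Ioi_same measurableSet_Ioi
        ((ki s hs.1.le 0 le_rfl).mono_set Ioc_subset_Ioi_self) (ki s hs.1.le _ hns),
        Ioc_union_Ioi_eq_Ioi hns]
    have h1 := hHs s hs.1.le
    have h2 := (abs_le.1 (kt s hs.1.le _ hns)).2
    rw [e1]
    linarith
  have hi1 : IntegrableOn (fun s => A * Real.exp (-γ * s)) (Ioc 0 n) :=
    Continuous.integrableOn_Ioc (by fun_prop)
  have hi2 : IntegrableOn (fun s => D / γ * Real.exp (-γ * (n - s))) (Ioc 0 n) :=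
    Continuous.integrableOn_Ioc (by fun_prop)
  have hi0 : IntegrableOn (fun _ : ℝ => c) (Ioc 0 n) :=
    Continuous.integrableOn_Ioc (by fun_prop)
  have hi3 : IntegrableOn (fun s => ∫ u in Ioc 0 n, if s + u ≤ n then k s u else 0) (Ioc 0 n) := by
    have m4 : Measurable (fun p : ℝ × ℝ => if p.1 + p.2 ≤ n then k p.1 p.2 else 0) :=
      Measurable.ite (measurableSet_le (by fun_prop) measurable_const) mk measurable_const
    refine (bdd_int (ν := (volume.restrict (Ioc 0 n)).prod (volume.restrict (Ioc 0 n))) m4 (C * C) fun p => abs_ite_le ?_).integral_prod_left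
    have := norm_integral_le_of_norm_le_const (μ := ℙ) (f := fun ω => G p.1 ω * G (p.1 + p.2) ω)
      (C := C * C) (ae_of_all _ fun ω => hCC _ _ ω)
    simpa [hkdef] using this
  have hfin := setIntegral_mono_on ((hi0.sub hi1).sub hi2) hi3 measurableSet_Ioc hin
  have e5 : ∫ s in Ioc 0 n, (c - A * Real.exp (-γ * s) - D / γ * Real.exp (-γ * (n - s))) =
      c * n - A * (∫ s in Ioc 0 n, Real.exp (-γ * s)) - D / γ * ∫ s in Ioc 0 n, Real.exp (-γ * (n - s)) := by
    have hi01 : IntegrableOn (fun s => c - A * Real.exp (-γ * s)) (Ioc 0 n) := hi0.sub hi1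
    rw [integral_sub hi01 hi2, integral_sub hi0 hi1, integral_const_mul, integral_const_mul]
    simp [hn, mul_comm]
  have h6 := mul_le_mul_of_nonneg_left (exp_int_le hγ n) hA0
  have h7 := mul_le_mul_of_nonneg_left (exp_int_le' hγ hn) (show 0 ≤ D / γ by positivity)
  simp only [Pi.sub_apply] at hfin
  linarith

lemma markov_prod {P : ℝ → X → Measure X} {ℙ : Measure Ω} [IsProbabilityMeasure ℙ]
    {Φ : ℝ → Ω → X} {μ : Measure X} (hΦ : IsMarkovProcess P Φ ℙ μ) {g : X → ℝ}
    (hm : Measurable g) {C : ℝ} (hC : ∀ x, |g x| ≤ C) {s u : ℝ} (hs : 0 ≤ s) (hu : 0 ≤ u) :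
    ∫ ω, g (Φ s ω) * g (Φ (s + u) ω) ∂ℙ = ∫ ω, g (Φ s ω) * funAct P u g (Φ s ω) ∂ℙ := by
  have mΦ : ∀ t, Measurable (Φ t) := fun t => hΦ.jointMeas.comp measurable_prodMk_left
  have hle : natFiltration Φ s ≤ (inferInstance : MeasurableSpace Ω) := by
    refine iSup₂_le fun v _ => ?_
    exact (mΦ v).comap_le
  have hsm : Measurable[natFiltration Φ s] (Φ s) := by
    have : MeasurableSpace.comap (Φ s) inferInstance ≤ natFiltration Φ s :=
      le_iSup₂_of_le (f := fun v (_ : v ∈ Set.Icc (0:ℝ) s) =>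
        MeasurableSpace.comap (Φ v) inferInstance) s ⟨hs, le_rfl⟩ le_rfl
    exact Measurable.mono (comap_measurable (Φ s)) this le_rfl
  have h1 : StronglyMeasurable[natFiltration Φ s] (fun ω => g (Φ s ω)) :=
    (hm.comp hsm).stronglyMeasurable
  have hi : Integrable (fun ω => g (Φ (s + u) ω)) ℙ :=
    bdd_int (hm.comp (mΦ _)) C fun ω => hC _
  have h2 := condExp_stronglyMeasurable_mul_of_bound hle h1 hi C (ae_of_all _ fun ω => hC _)
  have h3 := hΦ.markov g hm ⟨C, hC⟩ s u hs hu
  rw [← integral_condExp hle]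
  refine integral_congr_ae ?_
  filter_upwards [h2, h3] with ω a b
  have a' : (ℙ[fun ω => g (Φ s ω) * g (Φ (s + u) ω)|natFiltration Φ s]) ω = _ := a
  rw [a', b]
  rfl

lemma term1 {Z : Ω → ℝ} (hZ : Measurable Z) {ℙ : Measure Ω} [IsProbabilityMeasure ℙ] {r B s δ : ℝ}
    (hr : 2 < r) (hr4 : r ≤ 4) (hi : Integrable (fun ω => |Z ω| ^ r) ℙ)
    (hB : ∫ ω, |Z ω| ^ r ∂ℙ ≤ B) (hs : 0 < s) (hδ : 0 < δ) :
    0 ≤ (s⁻¹) ^ 4 * ∫ ω in {ω | |Z ω| < δ * s}, Z ω ^ 4 ∂ℙ ∧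
    (s⁻¹) ^ 4 * ∫ ω in {ω | |Z ω| < δ * s}, Z ω ^ 4 ∂ℙ ≤ δ ^ (4 - r) * B * s ^ (-r) := by
  have hS : MeasurableSet {ω | |Z ω| < δ * s} := measurableSet_lt hZ.abs measurable_const
  have hn : ∀ ω, 0 ≤ Z ω ^ 4 := fun ω => by positivity
  refine ⟨mul_nonneg (by positivity) (integral_nonneg hn), ?_⟩
  have hi' : Integrable (fun ω => (δ * s) ^ (4 - r) * |Z ω| ^ r) ℙ := hi.const_mul _
  have h1 : ∫ ω in {ω | |Z ω| < δ * s}, Z ω ^ 4 ∂ℙ ≤ (δ * s) ^ (4 - r) * B := by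
    calc ∫ ω in {ω | |Z ω| < δ * s}, Z ω ^ 4 ∂ℙ
        ≤ ∫ ω in {ω | |Z ω| < δ * s}, (δ * s) ^ (4 - r) * |Z ω| ^ r ∂ℙ := by
          refine integral_mono_of_nonneg (ae_of_all _ hn) hi'.restrict ?_
          filter_upwards [ae_restrict_mem hS] with ω hω
          have hω' : |Z ω| < δ * s := hω
          rcases eq_or_ne (Z ω) 0 with h0 | h0
          · simp only [h0, ne_eq, OfNat.ofNat_ne_zero, not_false_eq_true, zero_pow]
            positivity
          have hp : 0 < |Z ω| := abs_pos.2 h0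
          have e : Z ω ^ 4 = |Z ω| ^ (4 - r) * |Z ω| ^ r := by
            rw [← Real.rpow_add hp]
            have : (4 - r + r) = ((4 : ℕ) : ℝ) := by push_cast; ring
            rw [this, Real.rpow_natCast]
            exact (Even.pow_abs (by decide) _).symm
          rw [e]
          refine mul_le_mul_of_nonneg_right ?_ (by positivity)
          exact Real.rpow_le_rpow hp.le hω'.le (by linarith)
      _ ≤ ∫ ω, (δ * s) ^ (4 - r) * |Z ω| ^ r ∂ℙ :=
          setIntegral_le_integral hi' (ae_of_all _ fun ω => by
            show 0 ≤ (δ * s) ^ (4 - r) * |Z ω| ^ r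
            positivity)
      _ ≤ _ := by
          rw [integral_const_mul]
          exact mul_le_mul_of_nonneg_left hB (by positivity)
  refine (mul_le_mul_of_nonneg_left h1 (by positivity)).trans (le_of_eq ?_)
  rw [Real.mul_rpow hδ.le hs.le, sub_eq_add_neg, Real.rpow_add hs]
  have : s ^ (4:ℝ) = s ^ 4 := by exact_mod_cast Real.rpow_natCast s 4
  rw [this]
  field_simp

lemma term2 {Z : Ω → ℝ} (hZ : Measurable Z) {ℙ : Measure Ω} [IsProbabilityMeasure ℙ] {r B s ε : ℝ}
    (hr : 2 < r) (hi : Integrable (fun ω => |Z ω| ^ r) ℙ)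
    (hB : ∫ ω, |Z ω| ^ r ∂ℙ ≤ B) (hs : 0 < s) (hε : 0 < ε) :
    0 ≤ s⁻¹ * ∫ ω in {ω | ε * s ≤ |Z ω|}, |Z ω| ∂ℙ ∧
    s⁻¹ * ∫ ω in {ω | ε * s ≤ |Z ω|}, |Z ω| ∂ℙ ≤ ε ^ (1 - r) * B * s ^ (-r) := by
  have hS : MeasurableSet {ω | ε * s ≤ |Z ω|} := measurableSet_le measurable_const hZ.abs
  have hn : ∀ ω, 0 ≤ |Z ω| := fun ω => by positivity
  refine ⟨mul_nonneg (by positivity) (integral_nonneg hn), ?_⟩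
  have hi' : Integrable (fun ω => (ε * s) ^ (1 - r) * |Z ω| ^ r) ℙ := hi.const_mul _
  have hes : 0 < ε * s := by positivity
  have h1 : ∫ ω in {ω | ε * s ≤ |Z ω|}, |Z ω| ∂ℙ ≤ (ε * s) ^ (1 - r) * B := by
    calc ∫ ω in {ω | ε * s ≤ |Z ω|}, |Z ω| ∂ℙ
        ≤ ∫ ω in {ω | ε * s ≤ |Z ω|}, (ε * s) ^ (1 - r) * |Z ω| ^ r ∂ℙ := by
          refine integral_mono_of_nonneg (ae_of_all _ hn) hi'.restrict ?_
          filter_upwards [ae_restrict_mem hS] with ω hω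
          have hω' : ε * s ≤ |Z ω| := hω
          have hp : 0 < |Z ω| := hes.trans_le hω'
          have e : |Z ω| = |Z ω| ^ (1 - r) * |Z ω| ^ r := by
            rw [← Real.rpow_add hp]
            simp
          conv_lhs => rw [e]
          refine mul_le_mul_of_nonneg_right ?_ (by positivity)
          exact Real.rpow_le_rpow_of_nonpos hes hω' (by linarith)
      _ ≤ ∫ ω, (ε * s) ^ (1 - r) * |Z ω| ^ r ∂ℙ :=
          setIntegral_le_integral hi' (ae_of_all _ fun ω => by
            show 0 ≤ (ε * s) ^ (1 - r) * |Z ω| ^ r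
            positivity)
      _ ≤ _ := by
          rw [integral_const_mul]
          exact mul_le_mul_of_nonneg_left hB (by positivity)
  refine (mul_le_mul_of_nonneg_left h1 (by positivity)).trans (le_of_eq ?_)
  rw [Real.mul_rpow hε.le hs.le]
  have : s ^ (1 - r) = s * s ^ (-r) := by
    rw [sub_eq_add_neg, Real.rpow_add hs, Real.rpow_one]
  rw [this]
  field_simp

lemma summ {f s2 : ℕ → ℝ} {c K r : ℝ} (hc : 0 < c) (hK : 0 ≤ K) (hr : 2 < r)
    (hs : ∀ᶠ n : ℕ in atTop, c * n ≤ s2 n)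
    (hf : ∀ᶠ n : ℕ in atTop, 0 ≤ f n ∧ f n ≤ K * (Real.sqrt (s2 n)) ^ (-r)) : Summable f := by
  have hsum : Summable (fun n : ℕ => K * c ^ (-r / 2) * (n : ℝ) ^ (-r / 2)) :=
    (Real.summable_nat_rpow.2 (by linarith)).mul_left _
  refine Summable.of_norm_bounded_eventually_nat hsum ?_
  filter_upwards [hs, hf, eventually_gt_atTop 0] with n h1 h2 hn
  have hn' : (0:ℝ) < n := by exact_mod_cast hn
  rw [Real.norm_of_nonneg h2.1]
  refine h2.2.trans ?_
  rw [mul_assoc]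
  refine mul_le_mul_of_nonneg_left ?_ hK
  rw [← Real.mul_rpow hc.le hn'.le]
  have hcn : 0 < c * n := by positivity
  have e : Real.sqrt (s2 n) ^ (-r) = (s2 n) ^ (-r / 2) := by
    rw [Real.sqrt_eq_rpow, ← Real.rpow_mul (hcn.le.trans h1)]
    congr 1; ring
  rw [e]
  exact Real.rpow_le_rpow_of_nonpos hcn h1 (by linarith)

lemma add3_rpow {a b c r : ℝ} (ha : 0 ≤ a) (hb : 0 ≤ b) (hc : 0 ≤ c) (hr : 0 ≤ r) :
    (a + b + c) ^ r ≤ 3 ^ r * (a ^ r + b ^ r + c ^ r) := by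
  have h1 : 0 ≤ a ^ r := by positivity
  have h2 : 0 ≤ b ^ r := by positivity
  have h3 : 0 ≤ c ^ r := by positivity
  have key : ∀ m, 0 ≤ m → a ≤ m → b ≤ m → c ≤ m → m ^ r ≤ a ^ r + b ^ r + c ^ r →
      (a + b + c) ^ r ≤ 3 ^ r * (a ^ r + b ^ r + c ^ r) := by
    intro m hm x y z hh
    have : (a + b + c) ^ r ≤ (3 * m) ^ r := Real.rpow_le_rpow (by positivity) (by linarith) hr
    rw [Real.mul_rpow (by norm_num) hm] at this
    exact this.trans (mul_le_mul_of_nonneg_left hh (by positivity))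
  rcases le_total a b with h | h
  · rcases le_total b c with h' | h'
    · exact key c hc (h.trans h') h' le_rfl (by linarith)
    · exact key b hb h le_rfl h' (by linarith)
  · rcases le_total a c with h' | h'
    · exact key c hc h' (h.trans h') le_rfl (by linarith)
    · exact key a ha le_rfl h h' (by linarith)

end HS

/-- Lemma 8, conditions of Heyde–Scott. Under (A1)–(A4) and `σ_g² > 0`,
with `s_n² = E_μ[M_n(g)²]` positive for `n ≥ n̄`, the two Heyde–Scott series converge. -/
theorem heyde_scott_series_conditions
    (P : ℝ → X → Measure X) (hP : IsMarkovSemigroup P)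
    (γ ζ : ℝ) (x₀ : X) (μ μstar : Measure X)
    [IsProbabilityMeasure μ] [IsProbabilityMeasure μstar]
    (hA1 : CondA1 P) (hA2 : CondA2 P) (hA3 : CondA3 P γ) (hA4 : CondA4 P μ x₀ ζ)
    (hinv : ∀ t, 0 ≤ t → measAct P t μstar = μstar)
    (g : X → ℝ) (K : ℝ≥0) (hLip : LipschitzWith K g) (hBd : ∃ C, ∀ x, |g x| ≤ C)
    (hmean : ∫ x, g x ∂μstar = 0)
    (ℙμ : Measure Ω) [IsProbabilityMeasure ℙμ]
    (Φ : ℝ → Ω → X) (hΦ : IsMarkovProcess P Φ ℙμ μ)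
    (hσ : 0 < 2 * ∫ x, g x * corrector P g x ∂μstar)
    (s2 : ℕ → ℝ) (hs2 : ∀ n : ℕ, s2 n = ∫ ω, (mart P g Φ (n : ℝ) ω) ^ 2 ∂ℙμ)
    (nbar : ℕ) (hnbar : ∀ n, nbar ≤ n → 0 < s2 n) :
    (∀ δ : ℝ, 0 < δ →
      Summable (fun n : ℕ =>
        ((Real.sqrt (s2 (n + nbar)))⁻¹) ^ 4 *
          ∫ ω in {ω | |incr P g Φ (n + nbar) ω| < δ * Real.sqrt (s2 (n + nbar))},
            (incr P g Φ (n + nbar) ω) ^ 4 ∂ℙμ)) ∧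
    (∀ ε : ℝ, 0 < ε →
      Summable (fun n : ℕ =>
        (Real.sqrt (s2 (n + nbar)))⁻¹ *
          ∫ ω in {ω | ε * Real.sqrt (s2 (n + nbar)) ≤ |incr P g Φ (n + nbar) ω|},
            |incr P g Φ (n + nbar) ω| ∂ℙμ)) := by
  obtain ⟨C₀, hC₀⟩ := hBd
  set C : ℝ := |C₀| + 1 with hCdef
  have hCpos : 0 < C := by positivity
  have hC : ∀ x, |g x| ≤ C := fun x => (hC₀ x).trans (by rw [hCdef]; linarith [le_abs_self C₀])
  set L : ℝ := (K : ℝ) + 1 with hLdef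
  have hL : 0 < L := by positivity
  have hg : ∀ x y, |g x - g y| ≤ L * dist x y := by
    intro x y
    have h1 := hLip.dist_le_mul x y
    rw [Real.dist_eq] at h1
    have h2 : 0 ≤ dist x y := dist_nonneg
    rw [hLdef]; linarith
  have hm : Measurable g := hLip.continuous.measurable
  have hγ : 0 < γ := hA3.2.1
  have mΦ : ∀ t, Measurable (Φ t) := fun t => hΦ.jointMeas.comp measurable_prodMk_left
  have hpr : ∀ t, 0 ≤ t → IsProbabilityMeasure (measAct P t μ) := by
    intro t ht
    rw [← hΦ.law t ht]
    exact Measure.isProbabilityMeasure_map (mΦ t).aemeasurable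
  have hs := HS.star_moment hP hA3 μ μstar hA4 hpr hinv
  obtain ⟨hχi, hχl, hχb⟩ := HS.corr_props hP hA3 hL hg hm hC μstar hinv hs hmean
  have hdec := fun t (ht : 0 ≤ t) x => HS.decay hP hA3 hL hg hm hC μstar hinv hs hmean (t := t) ht x
  set m : ℝ := ∫ y, dist x₀ y ∂μstar with hmdef
  have hm0 : 0 ≤ m := integral_nonneg fun y => dist_nonneg
  obtain ⟨hζ, M, hM⟩ := hA4
  set M' : ℝ := 1 + max M 0 with hM'
  have hM'0 : 0 ≤ M' := by positivity
  have hmom : ∀ t, 0 ≤ t → ∀ r, 0 < r → r ≤ ζ → Integrable (fun x => dist x₀ x ^ r) (measAct P t μ) ∧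
      ∫ x, dist x₀ x ^ r ∂(measAct P t μ) ≤ M' := by
    intro t ht r hr hrz
    have := hpr t ht
    exact HS.mom_int' hr hrz (hM t ht)
  have hmom1 : ∀ t, 0 ≤ t → Integrable (fun x => dist x₀ x) (measAct P t μ) ∧
      ∫ x, dist x₀ x ∂(measAct P t μ) ≤ M' := by
    intro t ht
    have := hmom t ht 1 one_pos (by linarith)
    simpa using this
  set A : ℝ := L / γ with hA
  have hA0 : 0 < A := by positivity
  have hχc : Continuous (corrector P g) := (LipschitzWith.of_dist_le' (K := A) fun x y => by
    rw [Real.dist_eq]; exact hχl x y).continuous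
  have hχm : Measurable (corrector P g) := hχc.measurable
  -- second moments of the corrector
  set B2 : ℝ := 2 * A ^ 2 * (M' + m ^ 2) with hB2
  have hB : ∀ t, 0 ≤ t → Integrable (fun x => corrector P g x ^ 2) (measAct P t μ) ∧
      ∫ x, corrector P g x ^ 2 ∂(measAct P t μ) ≤ B2 := by
    intro t ht
    have := hpr t ht
    obtain ⟨h1, h2⟩ := hmom t ht 2 two_pos hζ.le
    have hb : ∀ x, corrector P g x ^ 2 ≤ 2 * A ^ 2 * (dist x₀ x ^ (2:ℝ) + m ^ 2) := by
      intro x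
      have h3 := pow_le_pow_left₀ (abs_nonneg _) (hχb x) 2
      rw [sq_abs] at h3
      rw [Real.rpow_two]
      nlinarith [sq_nonneg (A * (dist x₀ x - m))]
    have hi : Integrable (fun x => 2 * A ^ 2 * (dist x₀ x ^ (2:ℝ) + m ^ 2)) (measAct P t μ) :=
      (h1.add (integrable_const _)).const_mul _
    have hi2 : Integrable (fun x => corrector P g x ^ 2) (measAct P t μ) := by
      refine hi.mono' (hχm.pow_const 2).aestronglyMeasurable (ae_of_all _ fun x => ?_)
      rw [Real.norm_of_nonneg (by positivity)]
      exact hb x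
    refine ⟨hi2, (integral_mono hi2 hi hb).trans ?_⟩
    rw [integral_const_mul, integral_add h1 (integrable_const _), hB2]
    simp only [integral_const, probReal_univ, smul_eq_mul, one_mul]
    gcongr
  have hqi : ∀ t, 0 ≤ t → Integrable (corrector P g) (measAct P t μ) := by
    intro t ht
    have := hpr t ht
    exact HS.lip_integrable hχl hχm _ x₀ (hmom1 t ht).1
  obtain ⟨c, hc, T, hT0, hT⟩ := HS.lower_H hP hA3 hL hA0 hg hm hCpos hC hχl hχm μ μstar hpr hinv hB hqi
    (by linarith)
  -- the covariance function
  have hkν : ∀ s u, 0 ≤ s → 0 ≤ u → ∫ ω, g (Φ s ω) * g (Φ (s + u) ω) ∂ℙμ =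
      ∫ x, g x * funAct P u g x ∂(measAct P s μ) := by
    intro s u hs0 hu
    rw [HS.markov_prod hΦ hm hC hs0 hu, ← hΦ.law s hs0]
    exact (integral_map (f := fun x => g x * funAct P u g x) (mΦ s).aemeasurable
        (hm.mul (HS.meas_funAct_t hP hm u)).aestronglyMeasurable).symm
  have hk : ∀ s u, 0 ≤ s → 0 ≤ u → |∫ ω, g (Φ s ω) * g (Φ (s + u) ω) ∂ℙμ| ≤
      C * L * (M' + m) * Real.exp (-γ * u) := by
    intro s u hs0 hu
    have := hpr s hs0
    rw [hkν s u hs0 hu]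
    have hi : Integrable (fun x => C * L * Real.exp (-γ * u) * (dist x₀ x + m)) (measAct P s μ) :=
      ((hmom1 s hs0).1.add (integrable_const _)).const_mul _
    have h1 := norm_integral_le_of_norm_le (f := fun x => g x * funAct P u g x) hi (ae_of_all _ fun x => by
      rw [norm_mul]
      have := mul_le_mul (hC x) (hdec u hu x) (abs_nonneg _) hCpos.le
      refine this.trans (le_of_eq (by ring)))
    rw [integral_const_mul, integral_add (hmom1 s hs0).1 (integrable_const _)] at h1
    simp only [integral_const, probReal_univ, smul_eq_mul, one_mul, Real.norm_eq_abs] at h1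
    have h2 : C * L * Real.exp (-γ * u) * (∫ x, dist x₀ x ∂(measAct P s μ) + m) ≤
        C * L * Real.exp (-γ * u) * (M' + m) := by
      have := (hmom1 s hs0).2
      gcongr
    refine h1.trans (h2.trans (le_of_eq (by ring)))
  have hH : ∀ s, T ≤ s → c ≤ ∫ u in Ioi 0, ∫ ω, g (Φ s ω) * g (Φ (s + u) ω) ∂ℙμ := by
    intro s hTs
    have hs0 := hT0.trans hTs
    have := hpr s hs0
    refine (hT s hTs).trans (le_of_eq ?_)
    have e1 : ∫ u in Ioi 0, ∫ ω, g (Φ s ω) * g (Φ (s + u) ω) ∂ℙμ =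
        ∫ u in Ioi 0, ∫ x, g x * funAct P (max u 0) g x ∂(measAct P s μ) := by
      refine setIntegral_congr_fun measurableSet_Ioi fun u hu => ?_
      have hu' : (0:ℝ) < u := hu
      simp only [hkν s u hs0 hu'.le, max_eq_left hu'.le]
    rw [e1, integral_integral_swap]
    · congr 1
      ext x
      rw [integral_const_mul, corrector]
      congr 1
      refine setIntegral_congr_fun measurableSet_Ioi fun u hu => ?_
      have hu' : (0:ℝ) < u := hu
      simp only [max_eq_left hu'.le]
    · have hd : Integrable (fun p : ℝ × X => (1 * Real.exp (-γ * p.1)) * (C * L * (dist x₀ p.2 + m)))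
          ((volume.restrict (Ioi 0)).prod (measAct P s μ)) :=
        Integrable.mul_prod (HS.int_exp hγ 1 0).1
          (((hmom1 s hs0).1.add (integrable_const m)).const_mul (C * L))
      refine hd.mono' ?_ ?_
      · exact ((hm.comp measurable_snd).mul (HS.meas_funAct hP hm)).aestronglyMeasurable
      · have : ∀ᵐ p ∂((volume.restrict (Ioi (0:ℝ))).prod (measAct P s μ)), p.1 ∈ Ioi (0:ℝ) :=
          Measure.quasiMeasurePreserving_fst.ae (ae_restrict_mem measurableSet_Ioi)
        filter_upwards [this] with p hp
        have hp' : (0:ℝ) < p.1 := hp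
        simp only [Function.uncurry, max_eq_left hp'.le]
        rw [norm_mul]
        have := mul_le_mul (hC p.2) (hdec p.1 hp'.le p.2) (abs_nonneg _) hCpos.le
        refine this.trans (le_of_eq (by ring))
  have hGm : Measurable fun p : ℝ × Ω => g (Φ p.1 p.2) := hm.comp hΦ.jointMeas
  obtain ⟨R, hR⟩ := HS.I_lower (G := fun s ω => g (Φ s ω)) hGm (fun s ω => hC _) ℙμ hγ hc hk hH
  -- measurability
  have hIm : ∀ t, Measurable (addFun g Φ t) := by
    intro t
    have key : ∀ S : Set ℝ, Measurable (fun ω => ∫ s in S, g (Φ s ω)) := fun S =>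
      (hGm.stronglyMeasurable.integral_prod_left' (μ := volume.restrict S)).measurable
    exact (key (Ioc 0 t)).sub (key (Ioc t 0))
  have hMm : ∀ t, Measurable (mart P g Φ t) := fun t =>
    ((hχm.comp (mΦ t)).sub (hχm.comp (mΦ 0))).add (hIm t)
  have hZm : ∀ n, Measurable (incr P g Φ n) := fun n => (hMm _).sub (hMm _)
  have hcomp : ∀ t, 0 ≤ t → ∀ f : X → ℝ, Measurable f → Integrable f (measAct P t μ) →
      Integrable (fun ω => f (Φ t ω)) ℙμ ∧ ∫ ω, f (Φ t ω) ∂ℙμ = ∫ x, f x ∂(measAct P t μ) := by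
    intro t ht f hf hi
    rw [← hΦ.law t ht] at hi ⊢
    exact ⟨(integrable_map_measure hf.aestronglyMeasurable (mΦ t).aemeasurable).1 hi,
      (integral_map (mΦ t).aemeasurable hf.aestronglyMeasurable).symm⟩
  -- variance lower bound
  have hlow : ∀ n : ℕ, c * n - R / 2 - 4 * B2 ≤ s2 n := by
    intro n
    have hn : (0:ℝ) ≤ n := Nat.cast_nonneg n
    have hbI : ∀ ω, |addFun g Φ n ω| ≤ C * n := by
      intro ω
      have := intervalIntegral.norm_integral_le_of_norm_le_const (a := (0:ℝ)) (b := n)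
        (f := fun s => g (Φ s ω)) (C := C) (fun s _ => hC _)
      simpa [addFun] using this
    have hI2 : Integrable (fun ω => addFun g Φ n ω ^ 2) ℙμ := by
      refine HS.bdd_int ((hIm n).pow_const 2) ((C * n) ^ 2) fun ω => ?_
      rw [abs_pow]
      exact pow_le_pow_left₀ (abs_nonneg _) (hbI ω) 2
    obtain ⟨a1, a2⟩ := hcomp n hn _ (hχm.pow_const 2) (hB n hn).1
    obtain ⟨b1, b2⟩ := hcomp 0 le_rfl _ (hχm.pow_const 2) (hB 0 le_rfl).1
    have hM2 : Integrable (fun ω => mart P g Φ n ω ^ 2) ℙμ := by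
      refine (((a1.add b1).add hI2).const_mul 3).mono' ((hMm n).pow_const 2).aestronglyMeasurable
        (ae_of_all _ fun ω => ?_)
      rw [Real.norm_of_nonneg (by positivity)]
      simp only [mart, Pi.add_apply]
      nlinarith [sq_nonneg (corrector P g (Φ n ω) + corrector P g (Φ 0 ω)),
        sq_nonneg (corrector P g (Φ n ω) - addFun g Φ n ω),
        sq_nonneg (corrector P g (Φ 0 ω) + addFun g Φ n ω)]
    have hsum : Integrable (fun ω => (1/2) * addFun g Φ n ω ^ 2 -
        2 * (corrector P g (Φ n ω) ^ 2 + corrector P g (Φ 0 ω) ^ 2)) ℙμ :=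
      (hI2.const_mul _).sub ((a1.add b1).const_mul 2)
    have h1 := integral_mono hsum hM2 (fun ω => by
      simp only [mart]
      nlinarith [sq_nonneg (corrector P g (Φ n ω) + corrector P g (Φ 0 ω)),
        sq_nonneg (2 * (corrector P g (Φ n ω) - corrector P g (Φ 0 ω)) + addFun g Φ n ω)])
    have hab : Integrable (fun ω => 2 * (corrector P g (Φ n ω) ^ 2 + corrector P g (Φ 0 ω) ^ 2)) ℙμ :=
      (a1.add b1).const_mul 2
    rw [integral_sub (hI2.const_mul _) hab, integral_const_mul,
      integral_const_mul, integral_add a1 b1, a2, b2, ← hs2 n] at h1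
    have h2 := hR n hn
    have h3 := (hB n hn).2
    have h4 := (hB 0 le_rfl).2
    have h5 : ∫ ω, (∫ s in (0:ℝ)..n, g (Φ s ω)) ^ 2 ∂ℙμ = ∫ ω, addFun g Φ n ω ^ 2 ∂ℙμ := rfl
    rw [h5] at h2
    linarith
  have hev : ∀ᶠ n : ℕ in atTop, c / 2 * n ≤ s2 n := by
    obtain ⟨N, hN⟩ := exists_nat_ge ((R / 2 + 4 * B2) / (c / 2))
    filter_upwards [eventually_ge_atTop N] with n hn
    have h1 : (N : ℝ) ≤ n := by exact_mod_cast hn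
    have h2 := hN.trans h1
    rw [div_le_iff₀ (by positivity)] at h2
    linarith [hlow n]
  -- moments of the increments
  set r : ℝ := min ζ 4 with hr
  have hr2 : 2 < r := lt_min hζ (by norm_num)
  have hr4 : r ≤ 4 := min_le_right _ _
  have hrz : r ≤ ζ := min_le_left _ _
  have hr0 : 0 < r := by linarith
  set E : ℝ := 2 * A * m + C with hE
  have hE0 : 0 ≤ E := by positivity
  set B : ℝ := 3 ^ r * (A ^ r * M' + A ^ r * M' + E ^ r) with hBdef
  have hB0 : 0 ≤ B := by positivity
  have hZ : ∀ n : ℕ, 1 ≤ n → Integrable (fun ω => |incr P g Φ n ω| ^ r) ℙμ ∧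
      ∫ ω, |incr P g Φ n ω| ^ r ∂ℙμ ≤ B := by
    intro n hn
    have hn1 : (1:ℝ) ≤ n := by exact_mod_cast hn
    have hn0 : (0:ℝ) ≤ n := by linarith
    have hn0' : (0:ℝ) ≤ (n:ℝ) - 1 := by linarith
    have mr : Measurable (fun x : X => dist x₀ x ^ r) := by fun_prop
    obtain ⟨a1, a2⟩ := hcomp n hn0 _ mr (hmom n hn0 r hr0 hrz).1
    obtain ⟨b1, b2⟩ := hcomp ((n:ℝ) - 1) hn0' _ mr (hmom _ hn0' r hr0 hrz).1
    have hdom : Integrable (fun ω => 3 ^ r * (A ^ r * dist x₀ (Φ n ω) ^ r +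
        A ^ r * dist x₀ (Φ ((n:ℝ) - 1) ω) ^ r + E ^ r)) ℙμ :=
      (((a1.const_mul _).add (b1.const_mul _)).add (integrable_const _)).const_mul _
    have hle : ∀ ω, |incr P g Φ n ω| ^ r ≤ 3 ^ r * (A ^ r * dist x₀ (Φ n ω) ^ r +
        A ^ r * dist x₀ (Φ ((n:ℝ) - 1) ω) ^ r + E ^ r) := by
      intro ω
      have hGω : Measurable (fun s => g (Φ s ω)) := hGm.comp measurable_prodMk_right
      have hii : ∀ a b : ℝ, IntervalIntegrable (fun s => g (Φ s ω)) volume a b := fun a b =>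
        ⟨HS.bdd_int hGω C fun s => hC _, HS.bdd_int hGω C fun s => hC _⟩
      have hI : |addFun g Φ n ω - addFun g Φ ((n:ℝ) - 1) ω| ≤ C := by
        rw [addFun, addFun, intervalIntegral.integral_interval_sub_left (hii _ _) (hii _ _)]
        have := intervalIntegral.norm_integral_le_of_norm_le_const (a := (n:ℝ) - 1) (b := n)
          (f := fun s => g (Φ s ω)) (C := C) (fun s _ => hC _)
        simpa using this
      have h1 : |incr P g Φ n ω| ≤ A * dist x₀ (Φ n ω) + A * dist x₀ (Φ ((n:ℝ) - 1) ω) + E := by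
        have e : incr P g Φ n ω = (corrector P g (Φ n ω) - corrector P g (Φ ((n:ℝ) - 1) ω)) +
            (addFun g Φ n ω - addFun g Φ ((n:ℝ) - 1) ω) := by
          simp only [incr, mart]; ring
        rw [e]
        have t1 := abs_add_le (corrector P g (Φ n ω) - corrector P g (Φ ((n:ℝ) - 1) ω))
            (addFun g Φ n ω - addFun g Φ ((n:ℝ) - 1) ω)
        have t2 := abs_sub (corrector P g (Φ n ω)) (corrector P g (Φ ((n:ℝ) - 1) ω))
        have t3 := hχb (Φ n ω)
        have t4 := hχb (Φ ((n:ℝ) - 1) ω)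
        rw [hE]
        linarith
      refine (Real.rpow_le_rpow (abs_nonneg _) h1 hr0.le).trans ?_
      refine (HS.add3_rpow (by positivity) (by positivity) hE0 hr0.le).trans (le_of_eq ?_)
      rw [Real.mul_rpow hA0.le dist_nonneg, Real.mul_rpow hA0.le dist_nonneg]
    have hZi : Integrable (fun ω => |incr P g Φ n ω| ^ r) ℙμ := by
      refine hdom.mono' ((hZm n).abs.pow_const r).aestronglyMeasurable (ae_of_all _ fun ω => ?_)
      rw [Real.norm_of_nonneg (by positivity)]
      exact hle ω
    refine ⟨hZi, (integral_mono hZi hdom hle).trans ?_⟩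
    have hab : Integrable (fun ω => A ^ r * dist x₀ (Φ n ω) ^ r +
        A ^ r * dist x₀ (Φ ((n:ℝ) - 1) ω) ^ r) ℙμ := (a1.const_mul _).add (b1.const_mul _)
    rw [integral_const_mul, integral_add hab (integrable_const _),
      integral_add (a1.const_mul _) (b1.const_mul _), integral_const_mul, integral_const_mul, a2, b2, hBdef]
    have h5 := (hmom n hn0 r hr0 hrz).2
    have h6 := (hmom _ hn0' r hr0 hrz).2
    simp only [integral_const, probReal_univ, smul_eq_mul, one_mul]
    gcongr
  constructor
  · intro δ hδ
    refine (summable_nat_add_iff (f := fun n : ℕ => ((Real.sqrt (s2 n))⁻¹) ^ 4 *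
          ∫ ω in {ω | |incr P g Φ n ω| < δ * Real.sqrt (s2 n)},
            (incr P g Φ n ω) ^ 4 ∂ℙμ) nbar).2 ?_
    refine HS.summ (r := r) (c := c / 2) (K := δ ^ (4 - r) * B) (by positivity) (by positivity) hr2 hev ?_
    filter_upwards [eventually_ge_atTop nbar, eventually_ge_atTop 1] with n h1 h2
    obtain ⟨z1, z2⟩ := hZ n h2
    exact HS.term1 (hZm n) hr2 hr4 z1 z2 (Real.sqrt_pos.2 (hnbar n h1)) hδ
  · intro ε hε
    refine (summable_nat_add_iff (f := fun n : ℕ => (Real.sqrt (s2 n))⁻¹ *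
          ∫ ω in {ω | ε * Real.sqrt (s2 n) ≤ |incr P g Φ n ω|},
            |incr P g Φ n ω| ∂ℙμ) nbar).2 ?_
    refine HS.summ (r := r) (c := c / 2) (K := ε ^ (1 - r) * B) (by positivity) (by positivity) hr2 hev ?_
    filter_upwards [eventually_ge_atTop nbar, eventually_ge_atTop 1] with n h1 h2
    obtain ⟨z1, z2⟩ := hZ n h2
    exact HS.term2 (hZm n) hr2 z1 z2 (Real.sqrt_pos.2 (hnbar n h1)) hε

end
end
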